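/- Suppose f ∈ Homeo₀(T²) has an ε-upper-stable rotation set (in Homeo₀(T²)) with 0 < ε < 1. Then for any lift f̃ of f one has ρ_{ε/2}(f̃) = ρ(f̃), and moreover every (ε/2)-pseudo-orbit (x̃_i)_{i∈ℕ} of f̃ in ℝ² satisfies, for all n ∈ ℕ, d(x̃_n − x̃_0, n·ρ(f̃)) ≤ (16/(πε²))·(osc(f) + 2) + ε, where n·ρ(f̃) = {n v : v ∈ ρ(f̃)}. -/

import Mathlib

noncomputable section

open Metric Set Filter Topology MeasureTheory Pointwise

/-- The plane `ℝ²` with the Euclidean metric. -/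
abbrev R2 : Type := EuclideanSpace ℝ (Fin 2)

/-- The integer lattice `ℤ² ⊂ ℝ²`. -/
def intLattice : AddSubgroup R2 where
  carrier := {v : R2 | ∀ i, ∃ n : ℤ, v i = (n : ℝ)}
  add_mem' := by
    intro a b ha hb i
    obtain ⟨m, hm⟩ := ha i
    obtain ⟨n, hn⟩ := hb i
    exact ⟨m + n, by push_cast; rw [← hm, ← hn]; rfl⟩
  zero_mem' := fun i => ⟨0, by simp⟩
  neg_mem' := by
    intro a ha i
    obtain ⟨m, hm⟩ := ha i
    exact ⟨-m, by push_cast; rw [← hm]; rfl⟩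

/-- The torus `T² = ℝ²/ℤ²`, with the quotient (Euclidean) metric. -/
abbrev T2 : Type := R2 ⧸ intLattice

/-- The covering projection `π : ℝ² → T²`. -/
def pr : R2 → T2 := QuotientAddGroup.mk

instance : MeasurableSpace T2 := borel T2
instance : BorelSpace T2 := ⟨rfl⟩

/-- A fundamental domain `[0,1)²` for the lattice action. -/
def fundDomain : Set R2 := {x : R2 | ∀ i, x i ∈ Set.Ico (0 : ℝ) 1}

/-- Lebesgue (Haar) probability measure on the torus `T²`. -/
def lebT2 : Measure T2 := Measure.map pr (volume.restrict fundDomain)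

/-- `F : ℝ² → ℝ²` is a lift of `f : T² → T²` if `π ∘ F = f ∘ π` and
`F (x + w) = F x + w` for every lattice vector `w ∈ ℤ²`. -/
structure IsLift (f : T2 ≃ₜ T2) (F : R2 ≃ₜ R2) : Prop where
  proj : ∀ x : R2, pr (F x) = f (pr x)
  equivariant : ∀ x : R2, ∀ w ∈ intLattice, F (x + w) = F x + w

/-- `Homeo₀(T²)`: homeomorphisms of the torus isotopic to the identity,
characterized as those admitting a lift commuting with integer translations. -/
def Homeo0 : Set (T2 ≃ₜ T2) := {f | ∃ F : R2 ≃ₜ R2, IsLift f F}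

/-- `Homeo_{0,λ}(T²)`: elements of `Homeo₀(T²)` preserving Lebesgue measure. -/
def Homeo0Leb : Set (T2 ≃ₜ T2) :=
  {f | f ∈ Homeo0 ∧ MeasurePreserving f lebT2 lebT2}

/-- The uniform `C⁰` distance `d_{C⁰}(f,g) = sup_x d(f(x), g(x))` on torus maps. -/
def dC0 (f g : T2 ≃ₜ T2) : ℝ := ⨆ x : T2, dist (f x) (g x)

/-- The uniform distance `sup_{x ∈ ℝ²} ‖F(x) − G(x)‖` between maps of the plane. -/
def supDist (F G : R2 → R2) : ℝ := ⨆ x : R2, dist (F x) (G x)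

/-- The rotation set `ρ(F̃)` of a lift: all limits `(F̃^{n_k}(z_k) − z_k)/n_k`. -/
def rotSet (F : R2 ≃ₜ R2) : Set R2 :=
  {v | ∃ (z : ℕ → R2) (n : ℕ → ℕ), Tendsto n atTop atTop ∧
    Tendsto (fun k => (n k : ℝ)⁻¹ • ((⇑F)^[n k] (z k) - z k)) atTop (𝓝 v)}

/-- The rotation set of `f`, with fixed lift `F`, is `δ`-upper-stable in `H`. -/
def UpperStable (H : Set (T2 ≃ₜ T2)) (F : R2 ≃ₜ R2) (δ : ℝ) : Prop :=
  ∀ g ∈ H, ∀ G : R2 ≃ₜ R2, IsLift g G → supDist (⇑F) (⇑G) < δ →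
    rotSet G ⊆ rotSet F

/-- The rotation set of `f`, with fixed lift `F`, is `δ`-stable in `H`. -/
def StableRS (H : Set (T2 ≃ₜ T2)) (F : R2 ≃ₜ R2) (δ : ℝ) : Prop :=
  ∀ g ∈ H, ∀ G : R2 ≃ₜ R2, IsLift g G → supDist (⇑F) (⇑G) < δ →
    rotSet G = rotSet F

/-- `f` has a stable rotation set in `H`. -/
def HasStableRotSet (H : Set (T2 ≃ₜ T2)) (f : T2 ≃ₜ T2) : Prop :=
  ∃ F : R2 ≃ₜ R2, IsLift f F ∧ ∃ δ > 0, StableRS H F δ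

/-- `S` is open in `H` for the uniform `C⁰` topology. -/
def OpenIn (H S : Set (T2 ≃ₜ T2)) : Prop :=
  ∀ f ∈ S ∩ H, ∃ δ > 0, ∀ g ∈ H, dC0 f g < δ → g ∈ S

/-- `S` is dense in `H` for the uniform `C⁰` topology. -/
def DenseIn (H S : Set (T2 ≃ₜ T2)) : Prop :=
  ∀ f ∈ H, ∀ ε > 0, ∃ g ∈ S ∩ H, dC0 f g < ε

/-- `(x_i)_{0 ≤ i ≤ n}` is a finite `ε`-pseudo-orbit of `F`. -/
def IsPseudoOrbitUpTo (F : R2 → R2) (ε : ℝ) (x : ℕ → R2) (n : ℕ) : Prop :=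
  ∀ i < n, dist (F (x i)) (x (i + 1)) < ε

/-- `(x_i)_{i ∈ ℕ}` is an infinite `ε`-pseudo-orbit of `F`. -/
def IsPseudoOrbit (F : R2 → R2) (ε : ℝ) (x : ℕ → R2) : Prop :=
  ∀ i : ℕ, dist (F (x i)) (x (i + 1)) < ε

/-- The `ε`-pseudo-rotation set `ρ_ε(F̃)`. -/
def pseudoRotSet (F : R2 → R2) (ε : ℝ) : Set R2 :=
  {v | ∃ (n : ℕ → ℕ) (x : ℕ → ℕ → R2), Tendsto n atTop atTop ∧
    (∀ k, IsPseudoOrbitUpTo F ε (x k) (n k)) ∧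
    Tendsto (fun k => (n k : ℝ)⁻¹ • (x k (n k) - x k 0)) atTop (𝓝 v)}

/-- The oscillation `osc(f) = sup_{x,y} ‖(F(x) − x) − (F(y) − y)‖` of a lift. -/
def osc (F : R2 → R2) : ℝ := ⨆ p : R2 × R2, ‖(F p.1 - p.1) - (F p.2 - p.2)‖

/-- `f` has the shadowing property. -/
def Shadowing (f : T2 ≃ₜ T2) : Prop :=
  ∀ ε > 0, ∃ δ > 0, ∀ x : ℕ → T2, (∀ i, dist (f (x i)) (x (i + 1)) < δ) →
    ∃ z : T2, ∀ i, dist ((⇑f)^[i] z) (x i) < ε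

/-- `v ∈ ℚ² ⊂ ℝ²`. -/
def IsRationalPoint (v : R2) : Prop := ∀ i, ∃ q : ℚ, v i = (q : ℝ)



/-! ### basic facts -/

def Equi (F : R2 ≃ₜ R2) : Prop := ∀ x : R2, ∀ w ∈ intLattice, F (x + w) = F x + w

lemma Equi.symm {F : R2 ≃ₜ R2} (h : Equi F) : Equi F.symm := by
  intro x w hw
  apply F.injective
  rw [h _ _ hw]; simp

lemma Equi.trans {F G : R2 ≃ₜ R2} (h : Equi F) (h' : Equi G) : Equi (F.trans G) := by
  intro x w hw
  simp [h _ _ hw, h' _ _ hw]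

lemma pr_eq_iff (x y : R2) : pr x = pr y ↔ y - x ∈ intLattice := by
  unfold pr
  rw [QuotientAddGroup.eq, neg_add_eq_sub]

def descend (F : R2 → R2) (h : ∀ x : R2, ∀ w ∈ intLattice, F (x + w) = F x + w) : T2 → T2 :=
  Quotient.lift (fun x => pr (F x)) (by
    intro a b hab
    have h1 : b - a ∈ intLattice := (pr_eq_iff a b).1 (Quotient.sound hab)
    rw [pr_eq_iff]
    have := h a _ h1
    rw [add_sub_cancel] at this
    rw [this]; simpa using h1)

lemma descend_pr (F : R2 → R2) (h) (x : R2) : descend F h (pr x) = pr (F x) := rfl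

lemma pr_surj : Function.Surjective pr := Quotient.mk_surjective

lemma continuous_pr : Continuous pr := continuous_quot_mk

lemma descend_cont (F : R2 → R2) (h) (hc : Continuous F) : Continuous (descend F h) :=
  Continuous.quotient_lift (continuous_pr.comp hc) _

lemma exists_descend (F : R2 ≃ₜ R2) (h : Equi F) : ∃ g : T2 ≃ₜ T2, IsLift g F := by
  refine ⟨⟨⟨descend F h, descend F.symm h.symm, ?_, ?_⟩, ?_, ?_⟩, ⟨fun x => rfl, h⟩⟩
  · intro t; obtain ⟨x, rfl⟩ := pr_surj t
    show pr (F.symm (F x)) = pr x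
    rw [F.symm_apply_apply]
  · intro t; obtain ⟨x, rfl⟩ := pr_surj t
    show pr (F (F.symm x)) = pr x
    rw [F.apply_symm_apply]
  · exact descend_cont _ h F.continuous
  · exact descend_cont _ h.symm F.symm.continuous

lemma Equi.iterate {F : R2 ≃ₜ R2} (h : Equi F) (n : ℕ) (x w : R2) (hw : w ∈ intLattice) :
    (⇑F)^[n] (x + w) = (⇑F)^[n] x + w := by
  induction n generalizing x with
  | zero => rfl
  | succ n ih => rw [Function.iterate_succ_apply, h _ _ hw, ih, ← Function.iterate_succ_apply]

lemma rotSet_iff (F : R2 ≃ₜ R2) (v : R2) :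
    v ∈ rotSet F ↔ ∀ η > 0, ∀ N : ℕ, ∃ n ≥ N, ∃ z : R2,
      ‖(n : ℝ)⁻¹ • ((⇑F)^[n] z - z) - v‖ < η := by
  constructor
  · rintro ⟨z, n, hn, ht⟩ η hη N
    have h1 := hn.eventually_ge_atTop N
    have h2 := (Metric.tendsto_nhds.1 ht) η hη
    obtain ⟨k, hk1, hk2⟩ := (h1.and h2).exists
    exact ⟨n k, hk1, z k, by rwa [dist_eq_norm] at hk2⟩
  · intro h
    choose n hn z hz using fun k : ℕ => h (1 / ((k : ℝ) + 1)) (by positivity) k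
    refine ⟨z, n, tendsto_atTop_mono hn tendsto_id, ?_⟩
    rw [tendsto_iff_norm_sub_tendsto_zero]
    exact squeeze_zero (fun _ => norm_nonneg _) (fun k => (hz k).le)
      tendsto_one_div_add_atTop_nhds_zero_nat

lemma rotSet_of_approx (F : R2 ≃ₜ R2) (v : R2) (h : ∀ η > 0, ∃ v' ∈ rotSet F, ‖v' - v‖ < η) :
    v ∈ rotSet F := by
  rw [rotSet_iff]
  intro η hη N
  obtain ⟨v', hv', hd⟩ := h (η / 2) (by positivity)
  obtain ⟨n, hn, z, hz⟩ := (rotSet_iff F v').1 hv' (η / 2) (by positivity) N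
  refine ⟨n, hn, z, ?_⟩
  have := norm_add_le ((n : ℝ)⁻¹ • ((⇑F)^[n] z - z) - v') (v' - v)
  rw [sub_add_sub_cancel] at this
  linarith

/-! ### lattice rounding and boundedness of displacement -/

lemma exists_round (x : R2) : ∃ w ∈ intLattice, ‖x - w‖ ≤ 2 := by
  refine ⟨!₂[(⌊x 0⌋ : ℝ), (⌊x 1⌋ : ℝ)], ?_, ?_⟩
  · intro i; fin_cases i
    · exact ⟨⌊x 0⌋, by simp⟩
    · exact ⟨⌊x 1⌋, by simp⟩
  · rw [EuclideanSpace.norm_eq, Fin.sum_univ_two]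
    apply Real.sqrt_le_iff.2 ⟨by norm_num, ?_⟩
    have h0 := Int.floor_le (x 0)
    have h1 := Int.lt_floor_add_one (x 0)
    have h2 := Int.floor_le (x 1)
    have h3 := Int.lt_floor_add_one (x 1)
    simp only [PiLp.sub_apply, Real.norm_eq_abs, sq_abs, Matrix.cons_val_zero, Matrix.cons_val_one]
    nlinarith

lemma disp_bdd (F : R2 ≃ₜ R2) (h : Equi F) : ∃ C, ∀ x, ‖F x - x‖ ≤ C := by
  have hc : Continuous fun x => F x - x := F.continuous.sub continuous_id
  obtain ⟨C, hC⟩ := (isCompact_closedBall (0 : R2) 2).exists_bound_of_continuousOn hc.continuousOn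
  refine ⟨C, fun x => ?_⟩
  obtain ⟨w, hw, hx⟩ := exists_round x
  have := hC (x - w) (by simpa using hx)
  have h2 := h (x - w) w hw
  rw [sub_add_cancel] at h2
  have e : F x - x = F (x - w) - (x - w) := by rw [h2]; abel
  rw [e]; exact this

lemma osc_bound (F : R2 ≃ₜ R2) (h : Equi F) (x y : R2) :
    ‖(F x - x) - (F y - y)‖ ≤ osc F := by
  obtain ⟨C, hC⟩ := disp_bdd F h
  have : BddAbove (range fun p : R2 × R2 => ‖(F p.1 - p.1) - (F p.2 - p.2)‖) := by
    refine ⟨C + C, ?_⟩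
    rintro _ ⟨p, rfl⟩
    exact (norm_sub_le _ _).trans (add_le_add (hC _) (hC _))
  exact le_ciSup this (x, y)

lemma osc_iter (F : R2 ≃ₜ R2) (h : Equi F) (x z : R2) (n : ℕ) :
    ‖((⇑F)^[n] z - z) - (n : ℝ) • (F x - x)‖ ≤ n * osc F := by
  induction n with
  | zero => simp
  | succ n ih =>
    rw [Function.iterate_succ_apply']
    have h1 := osc_bound F h ((⇑F)^[n] z) x
    have : (F ((⇑F)^[n] z) - z) - ((n + 1 : ℕ) : ℝ) • (F x - x)
      = (((⇑F)^[n] z - z) - (n : ℝ) • (F x - x)) +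
        ((F ((⇑F)^[n] z) - (⇑F)^[n] z) - (F x - x)) := by
      push_cast; rw [add_smul, one_smul]; abel
    rw [this]
    refine (norm_add_le _ _).trans ?_
    push_cast; linarith

lemma osc_rot (F : R2 ≃ₜ R2) (h : Equi F) (v : R2) (hv : v ∈ rotSet F) (x : R2) :
    ‖(F x - x) - v‖ ≤ osc F := by
  apply le_of_forall_pos_lt_add
  intro η hη
  obtain ⟨n, hn, z, hz⟩ := (rotSet_iff F v).1 hv η hη 1
  have hn' : (0 : ℝ) < n := by exact_mod_cast hn
  have h1 := osc_iter F h x z n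
  have h2 : ‖(n : ℝ)⁻¹ • ((⇑F)^[n] z - z) - (F x - x)‖ ≤ osc F := by
    have e : (n : ℝ)⁻¹ • ((⇑F)^[n] z - z) - (F x - x)
        = (n : ℝ)⁻¹ • (((⇑F)^[n] z - z) - (n : ℝ) • (F x - x)) := by
      rw [smul_sub _ _ ((n : ℝ) • _), smul_smul, inv_mul_cancel₀ hn'.ne', one_smul]
    rw [e, norm_smul, norm_inv, Real.norm_of_nonneg hn'.le, inv_mul_le_iff₀ hn']
    exact h1
  have := norm_sub_le ((n : ℝ)⁻¹ • ((⇑F)^[n] z - z) - v)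
    ((n : ℝ)⁻¹ • ((⇑F)^[n] z - z) - (F x - x))
  rw [sub_sub_sub_cancel_left] at this
  linarith

/-! ### changing lift -/

lemma lift_diff {f : T2 ≃ₜ T2} {F G : R2 ≃ₜ R2} (hF : IsLift f F) (hG : IsLift f G) :
    ∃ w ∈ intLattice, ∀ x, F x = G x + w := by
  have hm : ∀ x, F x - G x ∈ intLattice := fun x => by
    rw [← pr_eq_iff, hF.proj, hG.proj]
  refine ⟨F 0 - G 0, hm 0, fun x => ?_⟩
  have hc : Continuous fun x => F x - G x := F.continuous.sub G.continuous
  have key : F x - G x = F 0 - G 0 := by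
    ext i
    have hci : Continuous fun x => (F x - G x) i :=
      (EuclideanSpace.proj i : R2 →L[ℝ] ℝ).continuous.comp hc
    have hpc : IsPreconnected (range fun x => (F x - G x) i) := isPreconnected_range hci
    by_contra hne
    wlog hlt : (F x - G x) i < (F 0 - G 0) i generalizing x
    · have hgt : (F 0 - G 0) i < (F x - G x) i := lt_of_le_of_ne (not_lt.1 hlt) (Ne.symm hne)
      obtain ⟨a, ha⟩ := hm 0 i
      have := hpc.Icc_subset ⟨0, rfl⟩ ⟨x, rfl⟩
      obtain ⟨b, hb⟩ := hm x i
      have hab : a + 1 ≤ b := by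
        have : (a : ℝ) < b := by rw [← ha, ← hb]; exact hgt
        exact_mod_cast this
      have hab' : (a : ℝ) + 1 ≤ b := by exact_mod_cast hab
      obtain ⟨y, hy⟩ := this (show (a : ℝ) + 1/2 ∈ _ by
        constructor
        · show (F 0 - G 0) i ≤ _
          rw [ha]; linarith
        · show _ ≤ (F x - G x) i
          rw [hb]; linarith)
      obtain ⟨k, hk⟩ := hm y i
      have hy : (F y - G y) i = (a : ℝ) + 1/2 := hy
      rw [hk] at hy
      have : (2 * k : ℝ) = 2 * a + 1 := by linarith
      have : (2 * k : ℤ) = 2 * a + 1 := by exact_mod_cast this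
      omega
    · obtain ⟨a, ha⟩ := hm 0 i
      have := hpc.Icc_subset ⟨x, rfl⟩ ⟨0, rfl⟩
      obtain ⟨b, hb⟩ := hm x i
      have hab : b + 1 ≤ a := by
        have : (b : ℝ) < a := by rw [← ha, ← hb]; exact hlt
        exact_mod_cast this
      have hab' : (b : ℝ) + 1 ≤ a := by exact_mod_cast hab
      obtain ⟨y, hy⟩ := this (show (b : ℝ) + 1/2 ∈ _ by
        constructor
        · show (F x - G x) i ≤ _
          rw [hb]; linarith
        · show _ ≤ (F 0 - G 0) i
          rw [ha]; linarith)
      obtain ⟨k, hk⟩ := hm y i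
      have hy : (F y - G y) i = (b : ℝ) + 1/2 := hy
      rw [hk] at hy
      have : (2 * k : ℝ) = 2 * b + 1 := by linarith
      have : (2 * k : ℤ) = 2 * b + 1 := by exact_mod_cast this
      omega
  rw [← key]; abel

lemma iter_shift {F G : R2 ≃ₜ R2} (hG : Equi G) (w : R2) (hw : w ∈ intLattice)
    (h : ∀ x, F x = G x + w) (n : ℕ) (z : R2) :
    (⇑F)^[n] z = (⇑G)^[n] z + (n : ℝ) • w := by
  induction n with
  | zero => simp
  | succ n ih =>
    rw [Function.iterate_succ_apply', Function.iterate_succ_apply', ih, h,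
      hG _ ((n : ℝ) • w)]
    · push_cast; rw [add_smul, one_smul, add_assoc]
    · rw [Nat.cast_smul_eq_nsmul]; exact intLattice.nsmul_mem hw n

lemma rotSet_shift {F G : R2 ≃ₜ R2} (hG : Equi G) (w : R2) (hw : w ∈ intLattice)
    (h : ∀ x, F x = G x + w) (v : R2) : v ∈ rotSet G → v + w ∈ rotSet F := by
  simp only [rotSet_iff]
  intro H η hη N
  obtain ⟨n, hn, z, hz⟩ := H η hη (N + 1)
  have hn' : (n : ℝ) ≠ 0 := by
    have : 0 < n := by omega
    positivity
  refine ⟨n, by omega, z, ?_⟩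
  rw [iter_shift hG w hw h]
  convert hz using 2
  rw [add_sub_right_comm, smul_add, smul_smul, inv_mul_cancel₀ hn', one_smul]
  abel

lemma stable_any_lift {f : T2 ≃ₜ T2} {F F₀ : R2 ≃ₜ R2} (hF : IsLift f F) (hF₀ : IsLift f F₀)
    {ε : ℝ} (h : UpperStable Homeo0 F₀ ε) : UpperStable Homeo0 F ε := by
  obtain ⟨w, hw, hd⟩ := lift_diff hF hF₀
  intro g hg G hG hs v hv
  let G' : R2 ≃ₜ R2 := G.trans (Homeomorph.addRight (-w))
  have hG' : ∀ x, G' x = G x + -w := fun x => rfl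
  have hl : IsLift g G' := by
    constructor
    · intro x
      rw [← hG.proj, pr_eq_iff, hG']
      simpa using hw
    · intro x u hu
      rw [hG', hG', hG.equivariant x u hu]; abel
  have hs' : supDist F₀ G' < ε := by
    have : supDist F₀ G' = supDist F G := by
      unfold supDist
      congr 1; ext x
      rw [hG', hd, dist_eq_norm, dist_eq_norm]; congr 1; abel
    rwa [this]
  have h1 := h g hg G' hl hs' (rotSet_shift (F := G') (G := G) hG.equivariant (-w)
    (intLattice.neg_mem hw) hG' v hv)
  have := rotSet_shift (F := F) (G := F₀) hF₀.equivariant w hw hd _ h1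
  simpa using this

/-! ### shears -/

def hgt (u x : R2) : ℝ := u 0 * x 1 - u 1 * x 0

lemma hgt_add (u x y : R2) : hgt u (x + y) = hgt u x + hgt u y := by
  simp [hgt]; ring

lemma hgt_smul (u x : R2) (t : ℝ) : hgt u (t • x) = t * hgt u x := by
  simp [hgt]; ring

lemma hgt_self (u : R2) : hgt u u = 0 := by simp [hgt]; ring

lemma hgt_cont (u : R2) : Continuous (hgt u) := by unfold hgt; fun_prop

lemma hgt_int {u w : R2} (hu : u ∈ intLattice) (hw : w ∈ intLattice) :
    ∃ n : ℤ, hgt u w = n := by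
  obtain ⟨a, ha⟩ := hu 0
  obtain ⟨b, hb⟩ := hu 1
  obtain ⟨c, hc⟩ := hw 0
  obtain ⟨d, hd⟩ := hw 1
  exact ⟨a * d - b * c, by simp [hgt, ha, hb, hc, hd]⟩

lemma circ_add_int (x : ℝ) (n : ℤ) : ((x + n : ℝ) : UnitAddCircle) = (x : UnitAddCircle) := by
  have h : ((n : ℝ) : UnitAddCircle) = 0 :=
    (AddCircle.coe_eq_zero_iff (1 : ℝ)).2 ⟨n, by simp⟩
  rw [AddCircle.coe_add, h, add_zero]

lemma circ_hgt_add {u w : R2} (hu : u ∈ intLattice) (hw : w ∈ intLattice) (x : R2) :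
    ((hgt u (x + w) : ℝ) : UnitAddCircle) = (hgt u x : UnitAddCircle) := by
  obtain ⟨n, hn⟩ := hgt_int hu hw
  rw [hgt_add, hn, circ_add_int]

lemma exists_shear {Ω : Type*} [TopologicalSpace Ω] [CompactSpace Ω] (P : Ω → R2)
    (hP : Continuous P) (t : Ω → ℝ) (ht : Continuous t) (α : ℝ) (hα : 0 ≤ α)
    (htα : ∀ ω, |t ω| ≤ α) (u : R2) (hu : u ∈ intLattice)
    (hinj : Function.Injective fun ω => ((hgt u (P ω) : ℝ) : UnitAddCircle)) :
    ∃ s : R2 ≃ₜ R2, Equi s ∧ (∀ ω, s (P ω) = P ω + t ω • u) ∧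
      ∀ x, ∃ τ : ℝ, |τ| ≤ α ∧ s x = x + τ • u := by
  have hec : Continuous fun ω => ((hgt u (P ω) : ℝ) : UnitAddCircle) :=
    (AddCircle.continuous_mk' 1).comp ((hgt_cont u).comp hP)
  have hemb := hec.isClosedEmbedding hinj
  let tb : BoundedContinuousFunction Ω ℝ := BoundedContinuousFunction.mkOfCompact ⟨t, ht⟩
  obtain ⟨A, hA1, hA2⟩ := tb.exists_extension_norm_eq_of_isClosedEmbedding hemb
  have hAn : ∀ y, |A y| ≤ α := fun y => by
    refine (A.norm_coe_le_norm y).trans ?_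
    rw [hA1]
    exact (BoundedContinuousFunction.norm_le hα).2 htα
  have hAP : ∀ ω, A ((hgt u (P ω) : ℝ) : UnitAddCircle) = t ω := fun ω => congrFun hA2 ω
  have hh : ∀ (x : R2) (τ : ℝ), hgt u (x + τ • u) = hgt u x := fun x τ => by
    rw [hgt_add, hgt_smul, hgt_self]; simp
  have hcA : Continuous fun x : R2 => A ((hgt u x : ℝ) : UnitAddCircle) :=
    A.continuous.comp ((AddCircle.continuous_mk' 1).comp (hgt_cont u))
  let s : R2 ≃ₜ R2 :=
    { toFun := fun x => x + A ((hgt u x : ℝ) : UnitAddCircle) • u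
      invFun := fun x => x + (-A ((hgt u x : ℝ) : UnitAddCircle)) • u
      left_inv := fun x => by simp only [hh]; rw [neg_smul]; abel
      right_inv := fun x => by simp only [hh]; rw [neg_smul]; abel
      continuous_toFun := continuous_id.add (hcA.smul continuous_const)
      continuous_invFun := continuous_id.add (hcA.neg.smul continuous_const) }
  have hs : ∀ x, s x = x + A ((hgt u x : ℝ) : UnitAddCircle) • u := fun x => rfl
  refine ⟨s, ?_, ?_, ?_⟩
  · intro x w hw
    rw [hs, hs, circ_hgt_add hu hw]; abel
  · intro ω; rw [hs, hAP]
  · intro x; exact ⟨_, hAn _, hs x⟩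

lemma exists_shears {Ω : Type*} [TopologicalSpace Ω] [CompactSpace Ω] (P : Ω → R2)
    (hP : Continuous P) (t : ℕ → Ω → ℝ) (α : ℕ → ℝ) (u : ℕ → R2) (k : ℕ)
    (ht : ∀ j < k, Continuous (t j)) (hα : ∀ j < k, 0 ≤ α j)
    (htα : ∀ j < k, ∀ ω, |t j ω| ≤ α j) (hu : ∀ j < k, u j ∈ intLattice)
    (hinj : ∀ j < k, Function.Injective fun ω =>
      ((hgt (u j) (P ω + ∑ i ∈ Finset.range j, t i ω • u i) : ℝ) : UnitAddCircle)) :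
    ∃ s : R2 ≃ₜ R2, Equi s ∧ (∀ ω, s (P ω) = P ω + ∑ i ∈ Finset.range k, t i ω • u i) ∧
      ∀ x, ∃ τ : ℕ → ℝ, (∀ j < k, |τ j| ≤ α j) ∧
        s x = x + ∑ i ∈ Finset.range k, τ i • u i := by
  induction k with
  | zero =>
    refine ⟨Homeomorph.refl _, fun x w hw => rfl, fun ω => by simp, fun x => ⟨0, by simp, by simp⟩⟩
  | succ k ih =>
    obtain ⟨s, hs1, hs2, hs3⟩ := ih (fun j hj => ht j (by omega)) (fun j hj => hα j (by omega))
      (fun j hj => htα j (by omega)) (fun j hj => hu j (by omega)) (fun j hj => hinj j (by omega))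
    obtain ⟨s', h1, h2, h3⟩ := exists_shear (fun ω => P ω + ∑ i ∈ Finset.range k, t i ω • u i)
      (by
        refine hP.add (continuous_finsetSum _ fun i hi => ?_)
        have := ht i (by have := Finset.mem_range.1 hi; omega)
        fun_prop) (t k) (ht k (by omega)) (α k) (hα k (by omega)) (htα k (by omega))
        (u k) (hu k (by omega)) (hinj k (by omega))
    refine ⟨s.trans s', hs1.trans h1, fun ω => ?_, fun x => ?_⟩
    · simp only [Homeomorph.trans_apply, hs2, h2, Finset.sum_range_succ, add_assoc]
    · obtain ⟨τ, hτ, hx⟩ := hs3 x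
      obtain ⟨τ', hτ', hx'⟩ := h3 (s x)
      refine ⟨Function.update τ k τ', fun j hj => ?_, ?_⟩
      · rcases eq_or_ne j k with rfl | hne
        · simpa using hτ'
        · simpa [hne] using hτ j (by omega)
      · simp only [Homeomorph.trans_apply, hx', Finset.sum_range_succ, Function.update_self]
        rw [hx, add_assoc]
        congr 2
        refine Finset.sum_congr rfl fun i hi => ?_
        have : i ≠ k := by have := Finset.mem_range.1 hi; omega
        simp [this]

/-! ### the zonotope approximating a disc -/

def eu (θ : ℝ) : R2 := !₂[Real.cos θ, Real.sin θ]

lemma eu0 (θ : ℝ) : eu θ 0 = Real.cos θ := by simp [eu]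
lemma eu1 (θ : ℝ) : eu θ 1 = Real.sin θ := by simp [eu]

lemma R2ext {x y : R2} (h0 : x 0 = y 0) (h1 : x 1 = y 1) : x = y := by
  ext i; fin_cases i
  · exact h0
  · exact h1

lemma R2norm (x : R2) : ‖x‖ = Real.sqrt (x 0 ^ 2 + x 1 ^ 2) := by
  rw [EuclideanSpace.norm_eq, Fin.sum_univ_two]; simp

lemma R2norm_le (x : R2) : ‖x‖ ≤ |x 0| + |x 1| := by
  rw [R2norm]
  apply Real.sqrt_le_iff.2 ⟨by positivity, ?_⟩
  nlinarith [sq_abs (x 0), sq_abs (x 1), mul_nonneg (abs_nonneg (x 0)) (abs_nonneg (x 1))]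

lemma polar (x : R2) : ∃ φ : ℝ, x = ‖x‖ • eu φ := by
  let z : ℂ := ⟨x 0, x 1⟩
  have hz : ‖z‖ = ‖x‖ := by
    rw [R2norm, Complex.norm_def, Complex.normSq_apply]; congr 1; ring
  refine ⟨z.arg, R2ext ?_ ?_⟩
  · have := Complex.norm_mul_cos_arg z
    rw [hz] at this
    simp [eu0, this, z]
  · have := Complex.norm_mul_sin_arg z
    rw [hz] at this
    simp [eu1, this, z]

def pf (φ : ℝ) : R2 →ₗ[ℝ] ℝ where
  toFun x := x 0 * Real.cos φ + x 1 * Real.sin φ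
  map_add' x y := by simp; ring
  map_smul' t x := by simp; ring

lemma pf_eu (φ θ : ℝ) : pf φ (eu θ) = Real.cos (θ - φ) := by
  simp [pf, eu, Real.cos_sub]

lemma abs_cos_sub_le (a b : ℝ) (hab : a ≤ b) :
    |Real.cos b - Real.cos a| ≤ ∫ x in a..b, |Real.sin x| := by
  have h : ∫ x in a..b, Real.sin x = Real.cos a - Real.cos b := integral_sin
  rw [abs_sub_comm, ← h]
  have := intervalIntegral.norm_integral_le_integral_norm (f := Real.sin) (μ := volume) hab
  simpa only [Real.norm_eq_abs] using this

lemma int_abs_sin (φ : ℝ) : ∫ x in (-φ)..(-φ + Real.pi), |Real.sin x| = 2 := by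
  have hp : Function.Periodic (fun x => |Real.sin x|) Real.pi := fun x => by
    simp [Real.sin_add_pi]
  rw [hp.intervalIntegral_add_eq (-φ) 0, zero_add]
  have : ∫ x in (0:ℝ)..Real.pi, |Real.sin x| = ∫ x in (0:ℝ)..Real.pi, Real.sin x := by
    apply intervalIntegral.integral_congr
    intro x hx
    rw [uIcc_of_le Real.pi_pos.le] at hx
    exact abs_of_nonneg (Real.sin_nonneg_of_nonneg_of_le_pi hx.1 hx.2)
  rw [this, integral_sin]; simp; norm_num

def zang (K j : ℕ) : ℝ := Real.pi * j / K

def zg (K j : ℕ) : R2 := eu (zang K (j + 1)) - eu (zang K j)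

lemma zono_sum_le (K : ℕ) (hK : 0 < K) (φ : ℝ) :
    ∑ j ∈ Finset.range K, |pf φ (zg K j)| ≤ 2 := by
  have hK' : (0 : ℝ) < K := by exact_mod_cast hK
  have h1 : ∀ j, |pf φ (zg K j)| ≤
      ∫ x in (zang K j - φ)..(zang K (j + 1) - φ), |Real.sin x| := fun j => by
    rw [zg, map_sub, pf_eu, pf_eu]
    apply abs_cos_sub_le
    have : zang K j ≤ zang K (j + 1) := by
      unfold zang
      have := Real.pi_pos
      push_cast
      gcongr
      linarith
    linarith
  refine (Finset.sum_le_sum fun j _ => h1 j).trans ?_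
  rw [intervalIntegral.sum_integral_adjacent_intervals (a := fun j => zang K j - φ)]
  · have e0 : zang K 0 - φ = -φ := by simp [zang]
    have e1 : zang K K - φ = -φ + Real.pi := by
      simp [zang, hK'.ne']; ring
    rw [e0, e1, int_abs_sin]
  · intro j _
    exact (Real.continuous_sin.abs).intervalIntegrable _ _

lemma zono_a (K : ℕ) (hK : 0 < K) (r : ℝ) (hr : 0 ≤ r) (s : ℕ → ℝ)
    (hs : ∀ j < K, |s j| ≤ r / 2) : ‖∑ j ∈ Finset.range K, s j • zg K j‖ ≤ r := by
  obtain ⟨φ, hφ⟩ := polar (∑ j ∈ Finset.range K, s j • zg K j)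
  set y := ∑ j ∈ Finset.range K, s j • zg K j with hy
  have h1 : pf φ y = ‖y‖ := by
    conv_lhs => rw [hφ]
    rw [map_smul, pf_eu]; simp
  rw [← h1, hy, map_sum]
  calc ∑ j ∈ Finset.range K, pf φ (s j • zg K j)
      ≤ ∑ j ∈ Finset.range K, (r / 2) * |pf φ (zg K j)| := by
        refine Finset.sum_le_sum fun j hj => ?_
        rw [map_smul, smul_eq_mul]
        refine (le_abs_self _).trans ?_
        rw [abs_mul]
        exact mul_le_mul_of_nonneg_right (hs j (Finset.mem_range.1 hj)) (abs_nonneg _)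
    _ = (r / 2) * ∑ j ∈ Finset.range K, |pf φ (zg K j)| := by rw [Finset.mul_sum]
    _ ≤ (r / 2) * 2 := by
        have := zono_sum_le K hK φ
        gcongr
    _ = r := by ring

lemma eu_lip (a b : ℝ) : ‖eu a - eu b‖ ≤ 2 * |a - b| := by
  refine (R2norm_le _).trans ?_
  have h0 : |Real.cos a - Real.cos b| ≤ |a - b| := Real.abs_cos_sub_cos_le a b
  have h1 : |Real.sin a - Real.sin b| ≤ |a - b| := Real.abs_sin_sub_sin_le a b
  simp only [PiLp.sub_apply, eu0, eu1]
  linarith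

lemma zono_vertex (K : ℕ) (hK : 0 < K) (k : ℕ) (hk : k ≤ K) :
    ∑ j ∈ Finset.range K, (if j < k then (1/2 : ℝ) else -(1/2)) • zg K j = eu (zang K k) := by
  have hK' : (0 : ℝ) < K := by exact_mod_cast hK
  have key : ∀ m, ∑ j ∈ Finset.range m, (if j < k then (1/2 : ℝ) else -(1/2)) • zg K j
      = if m ≤ k then (1/2 : ℝ) • (eu (zang K m) - eu (zang K 0)) else
        eu (zang K k) - (1/2 : ℝ) • (eu (zang K m) + eu (zang K 0)) := by
    intro m
    induction m with
    | zero => simp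
    | succ m ih =>
      rw [Finset.sum_range_succ, ih, zg]
      rcases lt_trichotomy m k with h | h | h
      · have h2 : m + 1 ≤ k := h
        simp only [h, h.le, h2, if_true]; module
      · subst h
        simp
        module
      · have h1 : ¬ m ≤ k := by omega
        have h2 : ¬ m < k := by omega
        have h3 : ¬ m + 1 ≤ k := by omega
        simp only [h1, h2, h3, if_false]; module
  have hKK : eu (zang K K) = - eu (zang K 0) := by
    have e1 : zang K K = Real.pi := by simp [zang, hK'.ne']
    have e0 : zang K 0 = 0 := by simp [zang]
    rw [e1, e0]
    apply R2ext <;> simp [eu]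
  rw [key, hKK]
  split_ifs with h
  · have : k = K := by omega
    rw [this, hKK]; module
  · module

lemma zono_b (K : ℕ) (hK : 0 < K) (r : ℝ) (v : R2) (hv : ‖v‖ ≤ r) :
    ∃ s : ℕ → ℝ, (∀ j, |s j| ≤ r / 2) ∧
      ‖∑ j ∈ Finset.range K, s j • zg K j - v‖ ≤ r * (2 * (Real.pi / K)) := by
  have hK' : (0 : ℝ) < K := by exact_mod_cast hK
  obtain ⟨φ, hφ⟩ := polar v
  obtain ⟨σ, hσ, ψ, hψ, he⟩ : ∃ σ : ℝ, |σ| = 1 ∧ ∃ ψ ∈ Ico 0 Real.pi, eu φ = σ • eu ψ := by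
    refine ⟨(-1) ^ (toIcoDiv Real.pi_pos 0 φ), by simp [abs_zpow], toIcoMod Real.pi_pos 0 φ, ?_, ?_⟩
    · simpa using toIcoMod_mem_Ico Real.pi_pos 0 φ
    · have h := toIcoMod_add_toIcoDiv_zsmul Real.pi_pos 0 φ
      set m := toIcoDiv Real.pi_pos 0 φ
      set ψ := toIcoMod Real.pi_pos 0 φ
      rw [← h, zsmul_eq_mul]
      apply R2ext
      · simp [eu, Real.cos_add_int_mul_pi]
      · simp [eu, Real.sin_add_int_mul_pi]
  set k := ⌊ψ * K / Real.pi⌋₊ with hkd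
  have hpi := Real.pi_pos
  have hnn : 0 ≤ ψ * K / Real.pi := by have := hψ.1; positivity
  have hk1 : (k : ℝ) ≤ ψ * K / Real.pi := Nat.floor_le hnn
  have hk2 : ψ * K / Real.pi < k + 1 := Nat.lt_floor_add_one _
  rw [le_div_iff₀ hpi] at hk1
  rw [div_lt_iff₀ hpi] at hk2
  have hkK : k ≤ K := by
    have : (k : ℝ) * Real.pi ≤ K * Real.pi := by nlinarith [hψ.2]
    exact_mod_cast le_of_mul_le_mul_right this hpi
  have hang : |zang K k - ψ| ≤ Real.pi / K := by
    unfold zang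
    rw [abs_le]
    constructor
    · have : ψ ≤ Real.pi * k / K + Real.pi / K := by
        rw [← add_div, le_div_iff₀ hK']; linarith
      linarith
    · have : Real.pi * k / K ≤ ψ := by
        rw [div_le_iff₀ hK']; linarith
      have : 0 ≤ Real.pi / K := by positivity
      linarith
  refine ⟨fun j => (σ * ‖v‖) * (if j < k then (1/2 : ℝ) else -(1/2)), fun j => ?_, ?_⟩
  · rw [abs_mul, abs_mul, hσ, abs_norm]
    split_ifs
    · rw [abs_of_pos (by norm_num)]; linarith
    · rw [abs_neg, abs_of_pos (by norm_num)]; linarith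
  · simp only [mul_smul _ (ite _ _ _)]
    rw [← Finset.smul_sum, zono_vertex K hK k hkK]
    have e : (σ * ‖v‖) • eu (zang K k) - v = (σ * ‖v‖) • (eu (zang K k) - eu ψ) := by
      conv_lhs => rw [hφ, he]
      simp only [norm_smul, hσ, Real.norm_eq_abs]
      rw [smul_sub, smul_smul]
      congr 2
      · have h1 : |‖v‖| = ‖v‖ := abs_norm v
        have : ‖eu ψ‖ = 1 := by rw [R2norm]; simp [eu]
        rw [this]; simp
      · ring
    rw [e, norm_smul, Real.norm_eq_abs, abs_mul, hσ, abs_norm, one_mul]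
    have h1 := eu_lip (zang K k) ψ
    have h2 : 0 ≤ r := (norm_nonneg v).trans hv
    have h3 : ‖eu (zang K k) - eu ψ‖ ≤ 2 * (Real.pi / K) := h1.trans (by linarith)
    exact mul_le_mul hv h3 (norm_nonneg _) h2

lemma approx_lattice (g : R2) (δ : ℝ) (hδ : 0 < δ) :
    ∃ u ∈ intLattice, u ≠ 0 ∧ ∃ β : ℝ, 0 ≤ β ∧ ‖β • u - g‖ ≤ δ := by
  obtain ⟨N, hN⟩ := exists_nat_gt (2 / δ)
  have hN0 : (0 : ℝ) < N := lt_trans (by positivity) hN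
  obtain ⟨w, hw, hr⟩ := exists_round ((N : ℝ) • g)
  have hb : ‖(N : ℝ)⁻¹ • w - g‖ ≤ δ := by
    have e : (N : ℝ)⁻¹ • w - g = -((N : ℝ)⁻¹ • ((N : ℝ) • g - w)) := by
      rw [smul_sub, smul_smul, inv_mul_cancel₀ hN0.ne', one_smul]; abel
    rw [e, norm_neg, norm_smul, norm_inv, Real.norm_of_nonneg hN0.le, inv_mul_le_iff₀ hN0]
    rw [div_lt_iff₀ hδ] at hN
    linarith
  by_cases h0 : w = 0
  · refine ⟨eu 0, ?_, ?_, 0, le_rfl, ?_⟩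
    · intro i; fin_cases i
      · exact ⟨1, by simp [eu]⟩
      · exact ⟨0, by simp [eu]⟩
    · intro h
      have := congrArg (fun x : R2 => x 0) h
      simp [eu] at this
    · rw [h0] at hb; simpa using hb
  · exact ⟨w, hw, h0, (N : ℝ)⁻¹, by positivity, hb⟩

lemma zonotope (r : ℝ) (hr : 0 ≤ r) (η : ℝ) (hη : 0 < η) :
    ∃ (K : ℕ) (u : ℕ → R2) (α : ℕ → ℝ), (∀ j, u j ∈ intLattice ∧ u j ≠ 0 ∧ 0 ≤ α j) ∧
      (∀ τ : ℕ → ℝ, (∀ j < K, |τ j| ≤ α j) → ‖∑ j ∈ Finset.range K, τ j • u j‖ ≤ r + η) ∧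
      (∀ v : R2, ‖v‖ ≤ r → ∃ t : ℕ → ℝ, (∀ j, |t j| ≤ α j) ∧
        ‖∑ j ∈ Finset.range K, t j • u j - v‖ ≤ η) := by
  obtain ⟨K, hK⟩ := exists_nat_gt (r * (2 * Real.pi) / (η / 2))
  have hpi := Real.pi_pos
  have hK' : (0 : ℝ) < K := lt_of_le_of_lt (by positivity) hK
  have hK0 : 0 < K := by exact_mod_cast hK'
  set δ := η / (K * (r + 1)) with hδ
  have hδ0 : 0 < δ := by positivity
  choose u hu hu0 β hβ hd using fun j => approx_lattice (zg K j) δ hδ0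
  have herr : ∀ s : ℕ → ℝ, (∀ j < K, |s j| ≤ r / 2) →
      ‖∑ j ∈ Finset.range K, (s j * β j) • u j - ∑ j ∈ Finset.range K, s j • zg K j‖ ≤ η / 2 := by
    intro s hs
    rw [← Finset.sum_sub_distrib]
    calc ‖∑ j ∈ Finset.range K, ((s j * β j) • u j - s j • zg K j)‖
        ≤ ∑ j ∈ Finset.range K, (r / 2 * δ) := by
          refine norm_sum_le_of_le _ fun j hj => ?_
          rw [mul_smul, ← smul_sub, norm_smul]
          exact mul_le_mul (hs j (Finset.mem_range.1 hj)) (hd j) (norm_nonneg _) (by positivity)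
      _ = K * (r / 2 * δ) := by simp
      _ = (r / (r + 1)) * (η / 2) := by rw [hδ]; field_simp
      _ ≤ 1 * (η / 2) := by
          gcongr
          rw [div_le_one (by positivity)]; linarith
      _ = η / 2 := one_mul _
  refine ⟨K, u, fun j => r / 2 * β j, fun j => ⟨hu j, hu0 j, by have := hβ j; positivity⟩, ?_, ?_⟩
  · intro τ hτ
    have hs : ∀ j < K, |τ j / β j| ≤ r / 2 := fun j hj => by
      rw [abs_div, abs_of_nonneg (hβ j)]
      exact div_le_of_le_mul₀ (hβ j) (by positivity) (hτ j hj)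
    have h1 := herr (fun j => τ j / β j) hs
    have h2 := zono_a K hK0 r hr (fun j => τ j / β j) hs
    have e : ∑ j ∈ Finset.range K, (τ j / β j * β j) • u j = ∑ j ∈ Finset.range K, τ j • u j := by
      refine Finset.sum_congr rfl fun j hj => ?_
      congr 1
      by_cases hb : β j = 0
      · have := hτ j (Finset.mem_range.1 hj)
        simp only [hb, mul_zero] at this
        rw [abs_nonpos_iff.1 this]; simp
      · exact div_mul_cancel₀ _ hb
    simp only [e] at h1
    have := norm_add_le (∑ j ∈ Finset.range K, τ j • u j -
      ∑ j ∈ Finset.range K, (τ j / β j) • zg K j) (∑ j ∈ Finset.range K, (τ j / β j) • zg K j)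
    rw [sub_add_cancel] at this
    linarith
  · intro v hv
    obtain ⟨s, hs, hs2⟩ := zono_b K hK0 r v hv
    refine ⟨fun j => s j * β j, fun j => ?_, ?_⟩
    · rw [abs_mul, abs_of_nonneg (hβ j)]
      exact mul_le_mul_of_nonneg_right (hs j) (hβ j)
    · have h1 := herr s (fun j _ => hs j)
      have h3 : r * (2 * (Real.pi / K)) ≤ η / 2 := by
        rw [div_lt_iff₀ (by positivity)] at hK
        have : r * (2 * (Real.pi / K)) = r * (2 * Real.pi) / K := by ring
        rw [this, div_le_iff₀ hK']; linarith
      have := norm_add_le (∑ j ∈ Finset.range K, (s j * β j) • u j -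
        ∑ j ∈ Finset.range K, s j • zg K j) (∑ j ∈ Finset.range K, s j • zg K j - v)
      rw [sub_add_sub_cancel] at this
      linarith

/-! ### genericity -/

lemma circ_eq (a b : ℝ) (h : (a : UnitAddCircle) = (b : UnitAddCircle)) :
    ∃ n : ℤ, a = b + n := by
  rw [← sub_eq_zero, ← AddCircle.coe_sub, AddCircle.coe_eq_zero_iff (1 : ℝ)] at h
  obtain ⟨n, hn⟩ := h
  exact ⟨n, by simp at hn; linarith⟩

lemma finite_generic {V : Type*} [Finite V] (Φ : R2 → ℝ) (hc : Continuous Φ)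
    (hd : ∀ s, Dense {x | Φ x ≠ s}) (κ : V → ℝ) (y0 : V → R2) (η : ℝ) (hη : 0 < η) :
    ∃ y : V → R2, (∀ p, dist (y p) (y0 p) < η) ∧
      ∀ p p', p ≠ p' → ∀ n : ℤ, Φ (y p) + κ p ≠ Φ (y p') + κ p' + n := by
  classical
  have := Fintype.ofFinite V
  let ι := {q : V × V // q.1 ≠ q.2} × ℤ
  let A : ι → Set (V → R2) := fun q =>
    {y | Φ (y q.1.1.1) + κ q.1.1.1 ≠ Φ (y q.1.1.2) + κ q.1.1.2 + q.2}
  have hopen : ∀ q, IsOpen (A q) := fun q => by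
    apply isOpen_ne_fun
    · fun_prop
    · fun_prop
  have hdense : ∀ q, Dense (A q) := by
    rintro ⟨⟨⟨p, p'⟩, hpp⟩, n⟩ y
    have hpp : p ≠ p' := hpp
    have h1 := hd (Φ (y p') + κ p' + n - κ p) (y p)
    have h2 : Continuous fun x : R2 => Function.update y p x :=
      continuous_const.update p continuous_id
    have h3 := map_mem_closure (t := A ⟨⟨⟨p, p'⟩, hpp⟩, n⟩) h2 h1 (by
      intro x hx
      show Φ (Function.update y p x p) + κ p ≠ Φ (Function.update y p x p') + κ p' + n
      rw [Function.update_self, Function.update_of_ne hpp.symm]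
      intro h
      exact hx (by linarith))
    simpa using h3
  have hD := dense_iInter_of_isOpen hopen hdense
  obtain ⟨y, hy, hyd⟩ := hD.exists_dist_lt y0 hη
  refine ⟨y, fun p => ?_, fun p p' hpp n => ?_⟩
  · rw [dist_comm]; exact (dist_le_pi_dist y0 y p).trans_lt hyd
  · exact mem_iInter.1 hy ⟨⟨⟨p, p'⟩, hpp⟩, n⟩

section
variable {W : Type} [Fintype W] [TopologicalSpace W] [DiscreteTopology W]

def cval (Φ : R2 → ℝ) (κ : W → W → ℝ) (X : C(ℤ → W, R2)) (ω : ℤ → W) : UnitAddCircle :=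
  ((Φ (X ω) + κ (ω 0) (ω 1) : ℝ) : UnitAddCircle)

lemma cval_cont (Φ : R2 → ℝ) (hc : Continuous Φ) (κ : W → W → ℝ) :
    Continuous fun p : C(ℤ → W, R2) × (ℤ → W) => cval Φ κ p.1 p.2 := by
  unfold cval
  refine (AddCircle.continuous_mk' 1).comp ?_
  refine Continuous.add ?_ ?_
  · refine hc.comp ?_
    fun_prop
  · have h1 : Continuous fun q : W × W => κ q.1 q.2 := continuous_of_discreteTopology
    have h2 : Continuous fun p : C(ℤ → W, R2) × (ℤ → W) => (p.2 0, p.2 1) := by fun_prop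
    exact h1.comp h2

lemma sep_open (Φ : R2 → ℝ) (hc : Continuous Φ) (κ : W → W → ℝ) (i : ℤ) :
    IsOpen {X : C(ℤ → W, R2) | ∀ ω ω', ω i ≠ ω' i → cval Φ κ X ω ≠ cval Φ κ X ω'} := by
  rw [← isClosed_compl_iff]
  let S : Set (C(ℤ → W, R2) × ((ℤ → W) × (ℤ → W))) :=
    {q | q.2.1 i ≠ q.2.2 i} ∩ {q | cval Φ κ q.1 q.2.1 = cval Φ κ q.1 q.2.2}
  have hS : IsClosed S := by
    refine IsClosed.inter ?_ ?_
    · have h1 : IsClosed {q : W × W | q.1 ≠ q.2} := isClosed_discrete _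
      exact h1.preimage (f := fun q : C(ℤ → W, R2) × ((ℤ → W) × (ℤ → W)) => (q.2.1 i, q.2.2 i))
        (by fun_prop)
    · refine isClosed_eq ?_ ?_
      · exact (cval_cont Φ hc κ).comp
          (f := fun q : C(ℤ → W, R2) × ((ℤ → W) × (ℤ → W)) => (q.1, q.2.1)) (by fun_prop)
      · exact (cval_cont Φ hc κ).comp
          (f := fun q : C(ℤ → W, R2) × ((ℤ → W) × (ℤ → W)) => (q.1, q.2.2)) (by fun_prop)
  convert isClosedMap_fst_of_compactSpace _ hS using 1
  ext X
  simp only [mem_compl_iff, mem_ofPred_eq, mem_image, S]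
  push Not
  constructor
  · rintro ⟨ω, ω', h1, h2⟩
    exact ⟨(X, (ω, ω')), ⟨h1, h2⟩, rfl⟩
  · rintro ⟨⟨_, ω, ω'⟩, ⟨h1, h2⟩, rfl⟩
    exact ⟨ω, ω', h1, h2⟩

lemma window (X0 : C(ℤ → W, R2)) (η : ℝ) (hη : 0 < η) : ∃ s : Finset ℤ, ∀ ω ω' : ℤ → W,
    (∀ i ∈ s, ω i = ω' i) → dist (X0 ω) (X0 ω') < η := by
  have hD : IsCompact {q : (ℤ → W) × (ℤ → W) | η ≤ dist (X0 q.1) (X0 q.2)} :=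
    (isClosed_le continuous_const (by fun_prop)).isCompact
  obtain ⟨s, hs⟩ := hD.elim_finite_subcover
    (fun i : ℤ => {q : (ℤ → W) × (ℤ → W) | q.1 i ≠ q.2 i}) (fun i => by
      have h1 : IsOpen {q : W × W | q.1 ≠ q.2} := isOpen_discrete _
      exact h1.preimage (f := fun q : (ℤ → W) × (ℤ → W) => (q.1 i, q.2 i)) (by fun_prop)) (by
      rintro ⟨ω, ω'⟩ h
      have h : η ≤ dist (X0 ω) (X0 ω') := h
      rw [mem_iUnion]
      by_contra hcon
      push Not at hcon
      have : ω = ω' := funext fun i => by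
        by_contra h'
        exact hcon i h'
      rw [this, dist_self] at h
      linarith)
  refine ⟨s, fun ω ω' h => ?_⟩
  by_contra hcon
  have := hs (show (ω, ω') ∈ _ from not_lt.1 hcon)
  simp only [mem_iUnion] at this
  obtain ⟨i, hi, hne⟩ := this
  exact hne (h i hi)

lemma sep_dense (Φ : R2 → ℝ) (hc : Continuous Φ) (hd : ∀ s, Dense {x | Φ x ≠ s})
    (κ : W → W → ℝ) (i : ℤ) :
    Dense {X : C(ℤ → W, R2) | ∀ ω ω', ω i ≠ ω' i → cval Φ κ X ω ≠ cval Φ κ X ω'} := by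
  classical
  rw [Metric.dense_iff]
  intro X0 η hη
  rcases isEmpty_or_nonempty W with hW | ⟨⟨w0⟩⟩
  · exact ⟨X0, mem_ball_self hη, fun ω => (hW.false (ω 0)).elim⟩
  obtain ⟨s, hs⟩ := window X0 (η / 2) (by positivity)
  let s' : Finset ℤ := s ∪ {0, 1, i}
  have h0 : (0 : ℤ) ∈ s' := by simp [s']
  have h1 : (1 : ℤ) ∈ s' := by simp [s']
  have hi : i ∈ s' := by simp [s']
  let ext : (s' → W) → (ℤ → W) := fun p j => if h : j ∈ s' then p ⟨j, h⟩ else w0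
  let res : (ℤ → W) → (s' → W) := fun ω j => ω j
  obtain ⟨y, hy1, hy2⟩ := finite_generic Φ hc hd
    (fun p : s' → W => κ (p ⟨0, h0⟩) (p ⟨1, h1⟩)) (fun p => X0 (ext p)) (η / 2) (by positivity)
  have hres : Continuous res := by
    apply continuous_pi; intro j; exact continuous_apply _
  let X : C(ℤ → W, R2) := ⟨fun ω => y (res ω), continuous_of_discreteTopology.comp hres⟩
  refine ⟨X, ?_, ?_⟩
  · rw [mem_ball, ContinuousMap.dist_lt_iff hη]
    intro ω
    have a1 := hy1 (res ω)
    have a2 := hs (ext (res ω)) ω (fun j hj => by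
      have : j ∈ s' := by simp [s', hj]
      simp [ext, res, this])
    have := dist_triangle (y (res ω)) (X0 (ext (res ω))) (X0 ω)
    show dist (y (res ω)) (X0 ω) < η
    linarith
  · intro ω ω' hne heq
    have hne' : res ω ≠ res ω' := fun h => hne (congrFun h ⟨i, hi⟩)
    obtain ⟨n, hn⟩ := circ_eq _ _ heq
    exact hy2 _ _ hne' n hn

lemma generic {ι : Type*} [Countable ι] (Φ : ι → R2 → ℝ) (hc : ∀ k, Continuous (Φ k))
    (hd : ∀ k s, Dense {x | Φ k x ≠ s}) (κ : ι → W → W → ℝ) (X0 : C(ℤ → W, R2)) (η : ℝ)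
    (hη : 0 < η) : ∃ X : C(ℤ → W, R2), dist X X0 < η ∧
      ∀ k, Function.Injective fun ω => ((Φ k (X ω) + κ k (ω 0) (ω 1) : ℝ) : UnitAddCircle) := by
  have hD := dense_iInter_of_isOpen
    (f := fun q : ι × ℤ => {X : C(ℤ → W, R2) | ∀ ω ω', ω q.2 ≠ ω' q.2 →
      cval (Φ q.1) (κ q.1) X ω ≠ cval (Φ q.1) (κ q.1) X ω'})
    (fun q => sep_open _ (hc _) _ _) (fun q => sep_dense _ (hc _) (hd _) _ _)
  obtain ⟨X, hX, hXd⟩ := hD.exists_dist_lt X0 hη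
  refine ⟨X, by rwa [dist_comm], fun k ω ω' h => ?_⟩
  by_contra hne
  obtain ⟨i, hi⟩ := Function.ne_iff.1 hne
  exact mem_iInter.1 hX (k, i) ω ω' hi h

end

/-! ### the perturbation theorem -/

lemma dense_hgt (u : R2) (hu : u ≠ 0) (s : ℝ) : Dense {x | hgt u x ≠ s} := by
  intro x
  by_cases hx : hgt u x ≠ s
  · exact subset_closure hx
  push Not at hx
  let n : R2 := !₂[-u 1, u 0]
  have hn : hgt u n ≠ 0 := by
    intro h
    apply hu
    simp only [hgt, n] at h
    simp at h
    have h0 : u 0 = 0 := by nlinarith [sq_nonneg (u 0), sq_nonneg (u 1)]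
    have h1 : u 1 = 0 := by nlinarith [sq_nonneg (u 0), sq_nonneg (u 1)]
    exact R2ext (by simpa using h0) (by simpa using h1)
  have h1 : (0 : ℝ) ∈ closure ({0}ᶜ : Set ℝ) := dense_compl_singleton (0 : ℝ) 0
  have h2 : Continuous fun t : ℝ => x + t • n := by fun_prop
  have h3 := map_mem_closure (t := {x | hgt u x ≠ s}) h2 h1 (by
    intro t ht
    show hgt u (x + t • n) ≠ s
    rw [hgt_add, hgt_smul, hx]
    intro h
    have : t * hgt u n = 0 := by linarith
    rcases mul_eq_zero.1 this with h | h
    · exact ht h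
    · exact hn h)
  simpa using h3

lemma coord_abs_le (x : R2) (i : Fin 2) : |x i| ≤ ‖x‖ := by
  simpa using PiLp.norm_apply_le x i

lemma eu_basis (x : R2) : x 0 • eu 0 + x 1 • (!₂[0, 1] : R2) = x := by
  apply R2ext <;> simp [eu]

lemma perturb (F : R2 ≃ₜ R2) (hF : Equi F) {W : Type} [Fintype W] [TopologicalSpace W]
    [DiscreteTopology W] (x : W → R2) (E : W → W → Prop) (c : W → W → R2)
    (hcl : ∀ a b, E a b → c a b ∈ intLattice) (ε : ℝ) (hε : 0 < ε)
    (hj : ∀ a b, E a b → ‖x b + c a b - F (x a)‖ < ε) :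
    ∃ H : R2 ≃ₜ R2, Equi H ∧ (∃ ε' < ε, ∀ y, ‖H y - y‖ ≤ ε') ∧
      ∃ X : (ℤ → W) → R2, (∀ ω, ‖X ω - x (ω 0)‖ ≤ 1) ∧
        ∀ ω, E (ω 0) (ω 1) → H (F (X ω)) = X (fun i => ω (i + 1)) + c (ω 0) (ω 1) := by
  classical
  obtain ⟨r, hr0, hrε, hr⟩ : ∃ r, 0 ≤ r ∧ r < ε ∧
      ∀ a b, E a b → ‖x b + c a b - F (x a)‖ ≤ r := by
    have h1 : ∀ᶠ r in 𝓝[<] ε, ∀ a b, E a b → ‖x b + c a b - F (x a)‖ ≤ r := by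
      refine eventually_all.2 fun a => eventually_all.2 fun b => ?_
      by_cases hE : E a b
      · have := Ioo_mem_nhdsLT (hj a b hE)
        filter_upwards [this] with r hr _ using hr.1.le
      · exact Eventually.of_forall fun r h => (hE h).elim
    have h2 : ∀ᶠ r in 𝓝[<] ε, r ∈ Ioo 0 ε := Ioo_mem_nhdsLT hε
    obtain ⟨r, h1, h2⟩ := (h1.and h2).exists
    exact ⟨r, h2.1.le, h2.2, h1⟩
  set η := (ε - r) / 8 with hηd
  have hη : 0 < η := by rw [hηd]; linarith
  obtain ⟨K, u, α, hu, hza, hzb⟩ := zonotope r hr0 η hη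
  have hT : ∀ a b, ∃ t : ℕ → ℝ, (∀ j, |t j| ≤ α j) ∧
      (E a b → ‖∑ j ∈ Finset.range K, t j • u j - (x b + c a b - F (x a))‖ ≤ η) := by
    intro a b
    by_cases hE : E a b
    · obtain ⟨t, h1, h2⟩ := hzb _ (hr a b hE)
      exact ⟨t, h1, fun _ => h2⟩
    · exact ⟨0, fun j => by simpa using (hu j).2.2, fun h => (hE h).elim⟩
  choose T hTα hTE using hT
  let u' : ℕ → R2 := fun j => if j < K then u j else if j = K then eu 0 else !₂[0, 1]
  have hu'1 : ∀ j < K, u' j = u j := fun j hj => by simp [u', hj]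
  have hu'2 : u' K = eu 0 := by simp [u']
  have hu'3 : u' (K + 1) = !₂[0, 1] := by simp [u']
  have hu'l : ∀ j, u' j ∈ intLattice := by
    intro j
    simp only [u']
    split_ifs
    · exact (hu j).1
    · intro i; fin_cases i
      · exact ⟨1, by simp [eu]⟩
      · exact ⟨0, by simp [eu]⟩
    · intro i; fin_cases i
      · exact ⟨0, by simp⟩
      · exact ⟨1, by simp⟩
  have hu'0 : ∀ j, u' j ≠ 0 := by
    intro j
    simp only [u']
    split_ifs
    · exact (hu j).2.1
    · intro h
      have := congrArg (fun x : R2 => x 0) h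
      simp [eu] at this
    · intro h
      have := congrArg (fun x : R2 => x 1) h
      simp at this
  obtain ⟨δ, hδ0, hδ1, hδη, hδF⟩ : ∃ δ > 0, δ ≤ 1 ∧ δ ≤ η ∧
      ∀ a y, ‖y - x a‖ < δ → ‖F y - F (x a)‖ ≤ η := by
    have h1 : ∀ᶠ δ in 𝓝[>] (0 : ℝ), ∀ a, ∀ y, ‖y - x a‖ < δ → ‖F y - F (x a)‖ ≤ η := by
      refine eventually_all.2 fun a => ?_
      obtain ⟨d, hd, hd'⟩ := Metric.continuous_iff.1 F.continuous (x a) η hη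
      filter_upwards [Ioo_mem_nhdsGT hd] with δ hδ y hy
      have := hd' y (by rw [dist_eq_norm]; exact hy.trans hδ.2)
      rw [dist_eq_norm] at this
      exact this.le
    have h2 : ∀ᶠ δ in 𝓝[>] (0 : ℝ), δ ∈ Ioo 0 (min 1 η) := Ioo_mem_nhdsGT (by positivity)
    obtain ⟨δ, h1, h2⟩ := (h1.and h2).exists
    exact ⟨δ, h2.1, h2.2.le.trans (min_le_left _ _), h2.2.le.trans (min_le_right _ _), h1⟩
  let X0 : C(ℤ → W, R2) := ⟨fun ω => x (ω 0), by
    have : Continuous x := continuous_of_discreteTopology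
    fun_prop⟩
  obtain ⟨X, hXd, hXi⟩ := generic (ι := ℕ × Bool)
    (fun q y => if q.2 then hgt (u' q.1) (F y) else hgt (u' q.1) y)
    (by
      rintro ⟨j, _ | _⟩
      · simpa using hgt_cont (u' j)
      · simp only [if_true]
        exact (hgt_cont (u' j)).comp F.continuous)
    (by
      rintro ⟨j, _ | _⟩ s
      · simpa using dense_hgt (u' j) (hu'0 j) s
      · have := (dense_hgt (u' j) (hu'0 j) s).preimage F.isOpenMap
        simpa using this)
    (fun q a b => if q.2 then ∑ i ∈ Finset.range q.1, T a b i * hgt (u' q.1) (u' i) else 0)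
    X0 δ hδ0
  have hXx : ∀ ω, ‖X ω - x (ω 0)‖ < δ := fun ω => by
    have := (ContinuousMap.dist_lt_iff hδ0).1 hXd ω
    rwa [dist_eq_norm] at this
  let sh : (ℤ → W) → (ℤ → W) := fun ω i => ω (i + 1)
  have hshc : Continuous sh := continuous_pi fun i => continuous_apply _
  have hshi : Function.Injective sh := by
    intro ω ω' h
    funext i
    have := congrFun h (i - 1)
    simpa [sh] using this
  let Ω' := {ω : ℤ → W // E (ω 0) (ω 1)}
  have hΩ : CompactSpace Ω' := by
    apply isCompact_iff_compactSpace.1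
    have h1 : IsClosed {q : W × W | E q.1 q.2} := isClosed_discrete _
    exact (h1.preimage (f := fun ω : ℤ → W => (ω 0, ω 1)) (by fun_prop)).isCompact
  let P : Ω' → R2 := fun ω => F (X ω.1)
  let Q : Ω' → R2 := fun ω => X (sh ω.1) + c (ω.1 0) (ω.1 1)
  let PK : Ω' → R2 := fun ω => P ω + ∑ j ∈ Finset.range K, T (ω.1 0) (ω.1 1) j • u j
  have hdisc : ∀ {Y : Type} [TopologicalSpace Y] (g : W → W → Y),
      Continuous fun ω : Ω' => g (ω.1 0) (ω.1 1) := by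
    intro Y _ g
    have h1 : Continuous fun q : W × W => g q.1 q.2 := continuous_of_discreteTopology
    have h2 : Continuous fun ω : Ω' => (ω.1 0, ω.1 1) :=
      ((continuous_apply 0).comp continuous_subtype_val).prodMk
        ((continuous_apply 1).comp continuous_subtype_val)
    exact h1.comp h2
  have hPc : Continuous P := F.continuous.comp (X.continuous.comp continuous_subtype_val)
  have hQc : Continuous Q :=
    (X.continuous.comp (hshc.comp continuous_subtype_val)).add (hdisc c)
  have hPKc : Continuous PK :=
    hPc.add (hdisc fun a b => ∑ j ∈ Finset.range K, T a b j • u j)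
  have hQP : ∀ ω, ‖Q ω - PK ω‖ ≤ 3 * η := by
    intro ω
    have e : Q ω - PK ω = (X (sh ω.1) - x (ω.1 1)) - (F (X ω.1) - F (x (ω.1 0)))
        - (∑ j ∈ Finset.range K, T (ω.1 0) (ω.1 1) j • u j -
          (x (ω.1 1) + c (ω.1 0) (ω.1 1) - F (x (ω.1 0)))) := by
      simp only [Q, PK, P]; abel
    have h1 : ‖X (sh ω.1) - x (ω.1 1)‖ < δ := by simpa [sh] using hXx (sh ω.1)
    have h2 := hδF (ω.1 0) (X ω.1) (hXx ω.1)
    have h3 := hTE _ _ ω.2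
    rw [e]
    refine (norm_sub_le _ _).trans ?_
    have := norm_sub_le (X (sh ω.1) - x (ω.1 1)) (F (X ω.1) - F (x (ω.1 0)))
    linarith
  let t : ℕ → Ω' → ℝ := fun j ω => if j < K then T (ω.1 0) (ω.1 1) j else
    if j = K then (Q ω - PK ω) 0 else (Q ω - PK ω) 1
  have ht1 : ∀ j < K, ∀ ω, t j ω = T (ω.1 0) (ω.1 1) j := fun j hj ω => by simp only [t, hj, if_true]
  have ht2 : ∀ ω, t K ω = (Q ω - PK ω) 0 := fun ω => by simp [t]
  have ht3 : ∀ ω, t (K + 1) ω = (Q ω - PK ω) 1 := fun ω => by simp [t]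
  let α' : ℕ → ℝ := fun j => if j < K then α j else 3 * η
  have hPK : ∀ ω, P ω + ∑ i ∈ Finset.range K, t i ω • u' i = PK ω := by
    intro ω
    simp only [PK]
    congr 1
    refine Finset.sum_congr rfl fun i hi => ?_
    rw [ht1 i (Finset.mem_range.1 hi), hu'1 i (Finset.mem_range.1 hi)]
  have hend : ∀ ω, P ω + ∑ i ∈ Finset.range (K + 2), t i ω • u' i = Q ω := by
    intro ω
    rw [Finset.sum_range_succ, Finset.sum_range_succ, ← add_assoc, ← add_assoc, hPK, ht2, ht3,
      hu'2, hu'3, add_assoc, eu_basis]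
    abel
  obtain ⟨H, hH1, hH2, hH3⟩ := exists_shears P hPc t α' u' (K + 2)
    (by
      intro j hj
      by_cases h : j < K
      · have : t j = fun ω => T (ω.1 0) (ω.1 1) j := funext (ht1 j h)
        rw [this]
        exact hdisc fun a b => T a b j
      · have hc' : Continuous fun ω => Q ω - PK ω := hQc.sub hPKc
        by_cases h' : j = K
        · subst h'
          have : t j = fun ω => (Q ω - PK ω) 0 := funext ht2
          rw [this]
          exact (EuclideanSpace.proj (0 : Fin 2) : R2 →L[ℝ] ℝ).continuous.comp hc'
        · have h2 : j = K + 1 := by omega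
          subst h2
          have : t (K + 1) = fun ω => (Q ω - PK ω) 1 := funext ht3
          rw [this]
          exact (EuclideanSpace.proj (1 : Fin 2) : R2 →L[ℝ] ℝ).continuous.comp hc')
    (by
      intro j hj
      simp only [α']
      split_ifs
      · exact (hu j).2.2
      · linarith)
    (by
      intro j hj ω
      simp only [α', t]
      split_ifs
      · exact hTα _ _ _
      · exact (coord_abs_le _ _).trans (hQP ω)
      · exact (coord_abs_le _ _).trans (hQP ω))
    (fun j _ => hu'l j)
    (by
      intro j hj
      by_cases h : j ≤ K
      · have hi := (hXi (j, true)).comp (Subtype.val_injective (p := fun ω : ℤ → W => E (ω 0) (ω 1)))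
        convert hi using 1
        funext ω
        simp only [Function.comp]
        congr 1
        simp only [if_true, P]
        rw [hgt_add]
        congr 1
        have hlin : ∀ m ≤ K, hgt (u' j) (∑ i ∈ Finset.range m, t i ω • u' i)
            = ∑ i ∈ Finset.range m, T (ω.1 0) (ω.1 1) i * hgt (u' j) (u' i) := by
          intro m hm
          induction m with
          | zero => simp [hgt]
          | succ m ih =>
            rw [Finset.sum_range_succ, Finset.sum_range_succ, hgt_add, ih (by omega), hgt_smul,
              ht1 m (by omega)]
        exact hlin j h
      · have h2 : j = K + 1 := by omega
        subst h2
        have hi := ((hXi (K + 1, false)).comp hshi).comp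
          (Subtype.val_injective (p := fun ω : ℤ → W => E (ω 0) (ω 1)))
        convert hi using 1
        funext ω
        simp only [Function.comp]
        obtain ⟨n, hn⟩ := hgt_int (hu'l (K + 1)) (hcl _ _ ω.2)
        have e : hgt (u' (K + 1)) (P ω + ∑ i ∈ Finset.range (K + 1), t i ω • u' i)
            = hgt (u' (K + 1)) (X (sh ω.1)) + n := by
          rw [← hn, ← hgt_add]
          show _ = hgt (u' (K + 1)) (Q ω)
          rw [← hend ω, Finset.sum_range_succ _ (K + 1), ← add_assoc, hgt_add _ _ (_ • _),
            hgt_smul, hgt_self]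
          simp
        rw [e, circ_add_int]
        simp)
  refine ⟨H, hH1, ⟨r + η + 6 * η, by rw [hηd]; linarith, fun y => ?_⟩, X,
    fun ω => (hXx ω).le.trans hδ1, fun ω hE => ?_⟩
  · obtain ⟨τ, hτ, hy⟩ := hH3 y
    rw [hy, add_sub_cancel_left, Finset.sum_range_succ, Finset.sum_range_succ, hu'2, hu'3]
    have h1 := hza τ (fun j hj => by simpa [α', hj] using hτ j (by omega))
    have h2 : ∑ i ∈ Finset.range K, τ i • u' i = ∑ i ∈ Finset.range K, τ i • u i :=
      Finset.sum_congr rfl fun i hi => by rw [hu'1 i (Finset.mem_range.1 hi)]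
    have h3 : |τ K| ≤ 3 * η := by simpa [α'] using hτ K (by omega)
    have h4 : |τ (K + 1)| ≤ 3 * η := by simpa [α'] using hτ (K + 1) (by omega)
    have h5 : ‖τ K • eu 0‖ = |τ K| := by
      rw [norm_smul]
      have : ‖eu 0‖ = 1 := by rw [R2norm]; simp [eu]
      rw [this, mul_one, Real.norm_eq_abs]
    have h6 : ‖τ (K + 1) • (!₂[0, 1] : R2)‖ = |τ (K + 1)| := by
      rw [norm_smul]
      have : ‖(!₂[0, 1] : R2)‖ = 1 := by rw [R2norm]; simp
      rw [this, mul_one, Real.norm_eq_abs]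
    rw [h2]
    refine (norm_add_le _ _).trans ?_
    have := norm_add_le (∑ i ∈ Finset.range K, τ i • u i) (τ K • eu 0)
    linarith
  · have := hH2 ⟨ω, hE⟩
    rw [hend] at this
    exact this

/-! ### paths -/

inductive Reach (E : ℕ → ℕ → Prop) (c : ℕ → ℕ → R2) : ℕ → ℕ → ℕ → R2 → Prop
  | refl (a : ℕ) : Reach E c a a 0 0
  | step (a b d t : ℕ) (w : R2) (h : E a b) (h2 : Reach E c b d t w) :
      Reach E c a d (t + 1) (c a b + w)

lemma Reach.trans {E : ℕ → ℕ → Prop} {c : ℕ → ℕ → R2} {a b d t t' : ℕ} {w w' : R2}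
    (h : Reach E c a b t w) (h' : Reach E c b d t' w') : Reach E c a d (t + t') (w + w') := by
  induction h with
  | refl a => simpa using h'
  | step a b e t w h h2 ih =>
    have := Reach.step _ _ _ _ _ h (ih h')
    rw [← add_assoc] at this
    convert this using 1
    omega

lemma Reach.loop {E : ℕ → ℕ → Prop} {c : ℕ → ℕ → R2} {a t : ℕ} {w : R2}
    (h : Reach E c a a t w) (M : ℕ) : Reach E c a a (M * t) (M • w) := by
  induction M with
  | zero => simpa using Reach.refl a
  | succ M ih =>
    have := ih.trans h
    rwa [← succ_nsmul, ← Nat.succ_mul] at this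

lemma Reach.path {E : ℕ → ℕ → Prop} {c : ℕ → ℕ → R2} {a b t : ℕ} {w : R2}
    (h : Reach E c a b t w) : ∃ p : ℕ → ℕ, p 0 = a ∧ p t = b ∧ (∀ i < t, E (p i) (p (i + 1))) ∧
      ∑ i ∈ Finset.range t, c (p i) (p (i + 1)) = w := by
  induction h with
  | refl a => exact ⟨fun _ => a, rfl, rfl, by simp, by simp⟩
  | step a b d t w h h2 ih =>
    obtain ⟨p, h0, ht, hE, hs⟩ := ih
    refine ⟨fun i => Nat.casesOn i a p, rfl, ht, ?_, ?_⟩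
    · intro i hi
      cases i with
      | zero => simpa [h0] using h
      | succ i => exact hE i (by omega)
    · rw [Finset.sum_range_succ']
      simp only [h0, hs]
      abel

lemma reach_orbit (F H : R2 ≃ₜ R2) (hF : Equi F) (hH : Equi H) (n : ℕ) (x : ℕ → R2)
    (E : ℕ → ℕ → Prop) (c : ℕ → ℕ → R2) (hEn : ∀ a b, E a b → a ≤ n ∧ b ≤ n)
    (hcl : ∀ a b, E a b → c a b ∈ intLattice)
    (X : (ℤ → Fin (n + 1)) → R2) (hX : ∀ ω, ‖X ω - x (ω 0)‖ ≤ 1)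
    (hXE : ∀ ω : ℤ → Fin (n + 1), E (ω 0) (ω 1) →
      H (F (X ω)) = X (fun i => ω (i + 1)) + c (ω 0) (ω 1))
    (a b t : ℕ) (w : R2) (ha : a ≤ n) (hb : b ≤ n) (h : Reach E c a b t w) :
    ∃ z, ‖(⇑(F.trans H))^[t] z - z - w‖ ≤ 2 + ‖x b - x a‖ := by
  obtain ⟨p, h0, ht, hE, hs⟩ := h.path
  let ω : ℤ → Fin (n + 1) := fun i => Fin.ofNat (n + 1) (p i.toNat)
  have hω : ∀ i : ℕ, p i ≤ n → ((ω i : Fin (n + 1)) : ℕ) = p i := fun i hi => by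
    simp only [ω, Fin.ofNat, Int.toNat_natCast]
    exact Nat.mod_eq_of_lt (by omega)
  have hG : Equi (F.trans H) := hF.trans hH
  have hiter : ∀ m ≤ t, (⇑(F.trans H))^[m] (X ω) = X (fun i => ω (i + m)) +
      ∑ i ∈ Finset.range m, c (p i) (p (i + 1)) := by
    intro m hm
    induction m with
    | zero => simp
    | succ m ih =>
      have hl : ∑ i ∈ Finset.range m, c (p i) (p (i + 1)) ∈ intLattice :=
        intLattice.sum_mem fun i hi => hcl _ _ (hE i (by have := Finset.mem_range.1 hi; omega))
      rw [Function.iterate_succ_apply', ih (by omega), hG _ _ hl]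
      have hEm := hE m (by omega)
      have e0 : ((ω (0 + (m : ℤ)) : Fin (n + 1)) : ℕ) = p m := by
        rw [zero_add]; exact hω m (hEn _ _ hEm).1
      have e1 : ((ω (1 + (m : ℤ)) : Fin (n + 1)) : ℕ) = p (m + 1) := by
        have : (1 + (m : ℤ)) = ((m + 1 : ℕ) : ℤ) := by push_cast; ring
        rw [this]; exact hω (m + 1) (hEn _ _ hEm).2
      have h1 := hXE (fun i => ω (i + m)) (by simp only [e0, e1]; exact hEm)
      simp only [e0, e1] at h1
      rw [Homeomorph.trans_apply, h1, Finset.sum_range_succ]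
      have e2 : (fun i : ℤ => ω (i + 1 + m)) = fun i => ω (i + ((m + 1 : ℕ) : ℤ)) := by
        funext i; congr 1; push_cast; ring
      rw [e2]; abel
  refine ⟨X ω, ?_⟩
  rw [hiter t le_rfl, hs]
  have e : X (fun i => ω (i + t)) + w - X ω - w =
      (X (fun i => ω (i + t)) - x b) - (X ω - x a) + (x b - x a) := by abel
  have h1 : ‖X (fun i => ω (i + t)) - x b‖ ≤ 1 := by
    have := hX (fun i => ω (i + t))
    simp only [zero_add] at this
    rwa [hω t (by omega), ht] at this
  have h2 : ‖X ω - x a‖ ≤ 1 := by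
    have := hX ω
    have e3 := hω 0 (by omega)
    simp only [Nat.cast_zero] at e3
    rwa [e3, h0] at this
  rw [e]
  have := norm_add_le ((X (fun i => ω (i + t)) - x b) - (X ω - x a)) (x b - x a)
  have := norm_sub_le (X (fun i => ω (i + t)) - x b) (X ω - x a)
  linarith

lemma reach_rot (F : R2 ≃ₜ R2) (hF : Equi F) (ε : ℝ) (hε : 0 < ε)
    (hst : UpperStable Homeo0 F ε) (n : ℕ) (x : ℕ → R2)
    (E : ℕ → ℕ → Prop) (c : ℕ → ℕ → R2) (hEn : ∀ a b, E a b → a ≤ n ∧ b ≤ n)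
    (hcl : ∀ a b, E a b → c a b ∈ intLattice)
    (hj : ∀ a b, E a b → ‖x b + c a b - F (x a)‖ < ε)
    (a b m L : ℕ) (w : R2) (ha : a ≤ n) (hb : b ≤ n) (hL : 0 < L)
    (h : ∀ M : ℕ, Reach E c a b (m + M * L) (M • w)) : (L : ℝ)⁻¹ • w ∈ rotSet F := by
  obtain ⟨H, hH, ⟨ε', hε', hHd⟩, X, hX, hXE⟩ := perturb F hF (W := Fin (n + 1))
    (fun a => x a) (fun a b => E a b) (fun a b => c a b) (fun a b => hcl a b) ε hε
    (fun a b => hj a b)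
  have hG : Equi (F.trans H) := hF.trans hH
  obtain ⟨g, hg⟩ := exists_descend _ hG
  refine hst g ⟨_, hg⟩ (F.trans H) hg ?_ ?_
  · refine lt_of_le_of_lt (ciSup_le fun y => ?_) hε'
    rw [dist_comm, dist_eq_norm]
    exact hHd (F y)
  rw [rotSet_iff]
  intro η hη N
  have hLr : (0 : ℝ) < L := by exact_mod_cast hL
  set C := 2 + ‖x b - x a‖ + (m : ℝ) * ‖(L : ℝ)⁻¹ • w‖ with hC
  have hC0 : 0 < C := by positivity
  obtain ⟨M, hM⟩ := exists_nat_gt (C / η)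
  have hnM : N + 1 + M ≤ m + (N + 1 + M) * L := by
    have : N + 1 + M ≤ (N + 1 + M) * L := Nat.le_mul_of_pos_right _ hL
    omega
  obtain ⟨z, hz⟩ := reach_orbit F H hF hH n x E c hEn hcl X hX (fun ω => hXE ω) a b _ _ ha hb
    (h (N + 1 + M))
  set k := m + (N + 1 + M) * L with hk
  refine ⟨k, by omega, z, ?_⟩
  have hk0 : (0 : ℝ) < k := by
    have : 0 < k := by omega
    exact_mod_cast this
  have e : (k : ℝ)⁻¹ • ((⇑(F.trans H))^[k] z - z) - (L : ℝ)⁻¹ • w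
      = (k : ℝ)⁻¹ • (((⇑(F.trans H))^[k] z - z - (N + 1 + M) • w) - (m : ℝ) • ((L : ℝ)⁻¹ • w)) := by
    have h1 : (N + 1 + M) • w + (m : ℝ) • ((L : ℝ)⁻¹ • w) = (k : ℝ) • ((L : ℝ)⁻¹ • w) := by
      rw [hk, ← Nat.cast_smul_eq_nsmul ℝ, smul_smul, smul_smul, ← add_smul]
      congr 1
      push_cast
      field_simp
      ring
    rw [sub_sub _ _ ((m : ℝ) • _), h1, smul_sub _ _ ((k : ℝ) • _), smul_smul (k : ℝ)⁻¹ (k : ℝ),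
      inv_mul_cancel₀ hk0.ne', one_smul]
  rw [e, norm_smul, norm_inv, Real.norm_of_nonneg hk0.le, inv_mul_lt_iff₀ hk0]
  have h2 := norm_sub_le ((⇑(F.trans H))^[k] z - z - (N + 1 + M) • w) ((m : ℝ) • ((L : ℝ)⁻¹ • w))
  rw [norm_smul (m : ℝ), Real.norm_of_nonneg (Nat.cast_nonneg m)] at h2
  have h3 : C < k * η := by
    rw [div_lt_iff₀ hη] at hM
    have : (M : ℝ) ≤ k := by
      have : M ≤ k := by omega
      exact_mod_cast this
    nlinarith
  linarith

/-! ### packing -/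

lemma ofLp_mem_aux (x : R2) : x ∈ fundDomain ↔ WithLp.ofLp x ∈ Set.pi univ fun _ : Fin 2 => Ico (0:ℝ) 1 := by
  simp [fundDomain]

lemma fund_meas : MeasurableSet fundDomain := by
  have : fundDomain = (WithLp.ofLp : R2 → (Fin 2 → ℝ)) ⁻¹' (Set.pi univ fun _ => Ico (0:ℝ) 1) := by
    ext x; exact ofLp_mem_aux x
  rw [this]
  exact (PiLp.volume_preserving_ofLp (Fin 2)).measurable
    (MeasurableSet.univ_pi fun _ => measurableSet_Ico)

lemma fund_vol : volume fundDomain = 1 := by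
  have : fundDomain = (WithLp.ofLp : R2 → (Fin 2 → ℝ)) ⁻¹' (Set.pi univ fun _ => Ico (0:ℝ) 1) := by
    ext x; exact ofLp_mem_aux x
  rw [this, (PiLp.volume_preserving_ofLp (Fin 2)).measure_preimage
    (MeasurableSet.univ_pi fun _ => measurableSet_Ico).nullMeasurableSet]
  rw [volume_pi_pi]
  simp

lemma lattice_ext_floor (x : R2) (w : R2) (hw : w ∈ intLattice) :
    w + x ∈ fundDomain ↔ w = !₂[-(⌊x 0⌋ : ℝ), -(⌊x 1⌋ : ℝ)] := by
  obtain ⟨a, ha⟩ := hw 0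
  obtain ⟨b, hb⟩ := hw 1
  constructor
  · intro h
    have h0 := h 0
    have h1 := h 1
    simp only [PiLp.add_apply, ha, hb, mem_Ico] at h0 h1
    have e0 : ⌊x 0⌋ = -a := by
      rw [Int.floor_eq_iff]; push_cast; constructor <;> linarith [h0.1, h0.2]
    have e1 : ⌊x 1⌋ = -b := by
      rw [Int.floor_eq_iff]; push_cast; constructor <;> linarith [h1.1, h1.2]
    apply R2ext
    · simp [e0, ha]
    · simp [e1, hb]
  · rintro rfl i
    fin_cases i
    · simpa using Int.floor_le (x 0)
    · simpa using Int.floor_le (x 1)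

lemma fund_dom : IsAddFundamentalDomain intLattice fundDomain volume := by
  refine IsAddFundamentalDomain.mk' fund_meas.nullMeasurableSet fun x => ?_
  have hm : (!₂[-(⌊x 0⌋ : ℝ), -(⌊x 1⌋ : ℝ)] : R2) ∈ intLattice := by
    intro i; fin_cases i
    · exact ⟨-⌊x 0⌋, by simp⟩
    · exact ⟨-⌊x 1⌋, by simp⟩
  refine ⟨⟨_, hm⟩, (lattice_ext_floor x _ hm).2 rfl, ?_⟩
  rintro ⟨w, hw⟩ h
  exact Subtype.ext ((lattice_ext_floor x w hw).1 h)

instance lattice_countable : Countable intLattice := by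
  have : Function.Injective fun w : intLattice => (⌊w.1 0⌋, ⌊w.1 1⌋) := by
    rintro ⟨w, hw⟩ ⟨w', hw'⟩ h
    obtain ⟨a, ha⟩ := hw 0
    obtain ⟨b, hb⟩ := hw 1
    obtain ⟨a', ha'⟩ := hw' 0
    obtain ⟨b', hb'⟩ := hw' 1
    simp [ha, hb, ha', hb'] at h
    apply Subtype.ext
    exact R2ext (by simp [ha, ha', h.1]) (by simp [hb, hb', h.2])
  exact this.countable

lemma lattice_norm (w : R2) (hw : w ∈ intLattice) (h : ‖w‖ < 1) : w = 0 := by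
  have key : ∀ i, w i = 0 := fun i => by
    obtain ⟨a, ha⟩ := hw i
    have := (coord_abs_le w i).trans_lt h
    rw [ha] at this
    have h2 : |a| < 1 := by
      rw [← Int.cast_lt (R := ℝ), Int.cast_abs, Int.cast_one]
      exact this
    rw [ha, Int.abs_lt_one_iff.1 h2]; simp
  exact R2ext (key 0) (key 1)

lemma packing (x : ℕ → R2) (ε : ℝ) (hε0 : 0 < ε) (hε1 : ε < 1) (S : Finset ℕ)
    (hS : ∀ s ∈ S, ∀ s' ∈ S, s ≠ s' → ∀ c ∈ intLattice, ε / 2 ≤ ‖x s' - x s - c‖) :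
    (S.card : ℝ) ≤ 16 / (Real.pi * ε ^ 2) := by
  have hpi := Real.pi_pos
  by_contra hcon
  push Not at hcon
  let B : Set R2 := ⋃ s ∈ S, ball (x s) (ε / 4)
  have hvol : volume B = S.card * (ENNReal.ofReal (ε / 4) ^ 2 * ENNReal.ofReal Real.pi) := by
    rw [measure_biUnion_finset]
    · simp [EuclideanSpace.volume_ball_fin_two]
    · intro s hs s' hs' hne
      refine ball_disjoint_ball ?_
      have := hS s hs s' hs' hne 0 (intLattice.zero_mem)
      rw [sub_zero, ← dist_eq_norm, dist_comm] at this
      linarith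
    · intro s _; exact measurableSet_ball
  have hgt1 : volume fundDomain < volume B := by
    rw [fund_vol, hvol, ← ENNReal.ofReal_pow (by positivity), ← ENNReal.ofReal_mul (by positivity),
      ← ENNReal.ofReal_natCast, ← ENNReal.ofReal_mul (by positivity), ← ENNReal.ofReal_one]
    apply (ENNReal.ofReal_lt_ofReal_iff_of_nonneg zero_le_one).2
    rw [div_lt_iff₀ (by positivity)] at hcon
    nlinarith
  obtain ⟨w, w', hne, hdis⟩ := exists_pair_mem_lattice_not_disjoint_vadd fund_dom
    (S.measurableSet_biUnion fun s _ => measurableSet_ball).nullMeasurableSet hgt1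
  rw [Set.not_disjoint_iff] at hdis
  obtain ⟨p, ⟨q, hq, hqp⟩, ⟨q', hq', hqp'⟩⟩ := hdis
  simp only [mem_iUnion] at hq hq'
  obtain ⟨s, hs, hqs⟩ := hq
  obtain ⟨s', hs', hqs'⟩ := hq'
  have e1 : w.1 + q = p := hqp
  have e2 : w'.1 + q' = p := hqp'
  rw [mem_ball, dist_eq_norm] at hqs hqs'
  have hn : ‖x s' - x s - (w.1 - w'.1)‖ < ε / 2 := by
    have : x s' - x s - (w.1 - w'.1) = (q - x s) - (q' - x s') := by
      have : q' = w.1 + q - w'.1 := by rw [e1, ← e2]; abel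
      rw [this]; abel
    rw [this]
    have := norm_sub_le (q - x s) (q' - x s')
    linarith
  by_cases hss : s = s'
  · subst hss
    rw [sub_self, zero_sub, norm_neg] at hn
    have := lattice_norm _ (intLattice.sub_mem w.2 w'.2) (by linarith)
    exact hne (Subtype.ext (sub_eq_zero.1 this))
  · have := hS s hs s' hs' hss _ (intLattice.sub_mem w.2 w'.2)
    linarith

/-! ### greedy decomposition of a pseudo-orbit -/

def PE (x : ℕ → R2) (n : ℕ) (ε : ℝ) (a b : ℕ) : Prop :=
  a < n ∧ (b = a + 1 ∨ (b ≤ a ∧ ∃ c ∈ intLattice, ‖x (a + 1) - x b - c‖ < ε / 2))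

open Classical in
def pc (x : ℕ → R2) (ε : ℝ) (a b : ℕ) : R2 :=
  if b = a + 1 then 0 else
    if h : ∃ c ∈ intLattice, ‖x (a + 1) - x b - c‖ < ε / 2 then Classical.choose h else 0

lemma pc_succ (x : ℕ → R2) (ε : ℝ) (a : ℕ) : pc x ε a (a + 1) = 0 := by simp [pc]

lemma pc_spec (x : ℕ → R2) (ε : ℝ) (a b : ℕ) (hb : b ≤ a)
    (h : ∃ c ∈ intLattice, ‖x (a + 1) - x b - c‖ < ε / 2) :
    pc x ε a b ∈ intLattice ∧ ‖x (a + 1) - x b - pc x ε a b‖ < ε / 2 := by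
  have hne : b ≠ a + 1 := by omega
  simp only [pc, hne, if_false, h, dif_pos]
  exact Classical.choose_spec h

lemma reach_straight (x : ℕ → R2) (n : ℕ) (ε : ℝ) (i k : ℕ) (h : i + k ≤ n) :
    Reach (PE x n ε) (pc x ε) i (i + k) k 0 := by
  induction k generalizing i with
  | zero => exact Reach.refl i
  | succ k ih =>
    have h1 := ih (i + 1) (by omega)
    have h2 := Reach.step i (i + 1) _ _ _ (show PE x n ε i (i + 1) from ⟨by omega, Or.inl rfl⟩) h1
    rw [pc_succ, add_zero] at h2
    convert h2 using 1
    omega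

lemma greedy (F : R2 → R2) (x : ℕ → R2) (n : ℕ) (ε : ℝ) (hε : 0 < ε)
    (hx : IsPseudoOrbitUpTo F (ε / 2) x n) (d : ℕ) : ∀ i ≤ n, n - i ≤ d →
    ∃ (S : Finset ℕ) (L : ℕ) (w : R2), (∀ s ∈ S, i ≤ s ∧ s ≤ n) ∧
      (∀ s ∈ S, ∀ s' ∈ S, s ≠ s' → ∀ c ∈ intLattice, ε / 2 ≤ ‖x s' - x s - c‖) ∧
      1 ≤ S.card ∧ n + 1 = i + L + S.card ∧
      (∀ M : ℕ, Reach (PE x n ε) (pc x ε) i n ((n - i) + M * L) (M • w)) ∧ (L = 0 → w = 0) ∧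
      ∀ (v : R2) (O : ℝ), (∀ y, ‖(F y - y) - v‖ ≤ O) →
        ‖x n - x i - w - ((S.card : ℝ) - 1) • v‖ ≤ ((S.card : ℝ) - 1) * (O + ε) + ε / 2 := by
  classical
  induction d with
  | zero =>
    intro i hi hd
    have : i = n := by omega
    subst this
    refine ⟨{i}, 0, 0, by simp, by simp, by simp, by simp, fun M => by simpa using Reach.refl i,
      fun _ => rfl, fun v O _ => ?_⟩
    simp; linarith
  | succ d ih =>
    intro i hi hd
    let cl : ℕ → Prop := fun j => ∃ c ∈ intLattice, ‖x j - x i - c‖ < ε / 2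
    have hcli : cl i := ⟨0, intLattice.zero_mem, by simpa using hε⟩
    obtain ⟨j, hij, hjn, hclj, hlast⟩ : ∃ j, i ≤ j ∧ j ≤ n ∧ cl j ∧ ∀ k, j < k → k ≤ n → ¬ cl k := by
      refine ⟨Nat.findGreatest cl n, Nat.le_findGreatest hi hcli, Nat.findGreatest_le n,
        Nat.findGreatest_spec hi hcli, fun k h1 h2 => Nat.findGreatest_is_greatest h1 h2⟩
    obtain ⟨c1, hc1, hc1R, hc10⟩ : ∃ c1 : R2, ‖x j - x i - c1‖ < ε / 2 ∧
        (Reach (PE x n ε) (pc x ε) i i (j - i) c1) ∧ (j - i = 0 → c1 = 0) := by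
      rcases eq_or_lt_of_le hij with h | h
      · subst h
        exact ⟨0, by simpa using hε, by simpa using Reach.refl i, fun _ => rfl⟩
      · obtain ⟨j', rfl⟩ : ∃ j', j = j' + 1 := ⟨j - 1, by omega⟩
        have hsp := pc_spec x ε j' i (by omega) hclj
        refine ⟨pc x ε j' i, hsp.2, ?_, fun h0 => by omega⟩
        have h1 := reach_straight x n ε i (j' - i) (by omega)
        have h2 : PE x n ε j' i := ⟨by omega, Or.inr ⟨by omega, hclj⟩⟩
        have h3 := Reach.step (c := pc x ε) _ _ _ _ _ h2 (Reach.refl i)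
        have e : i + (j' - i) = j' := by omega
        rw [e] at h1
        have h4 := h1.trans h3
        have e1 : (0 : R2) + (pc x ε j' i + 0) = pc x ε j' i := by abel
        have e2 : j' - i + (0 + 1) = j' + 1 - i := by omega
        rw [e1, e2] at h4
        exact h4
    rcases eq_or_lt_of_le hjn with h | hlt
    · subst h
      refine ⟨{i}, j - i, c1, by simpa using hij, by simp, by simp, by simp; omega, fun M => ?_,
        hc10, fun v O _ => ?_⟩
      · have h1 := reach_straight x j ε i (j - i) (by omega)
        have h2 := (hc1R.loop M).trans h1
        have e : i + (j - i) = j := by omega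
        rw [e, add_zero, add_comm] at h2
        exact h2
      · simp; linarith
    · obtain ⟨S, L, w, hS1, hS2, hS3, hS4, hS5, hS6, hS7⟩ := ih (j + 1) (by omega) (by omega)
      have hiS : i ∉ S := fun h => by have := (hS1 i h).1; omega
      refine ⟨insert i S, (j - i) + L, c1 + w, ?_, ?_, ?_, ?_, ?_, ?_, ?_⟩
      · intro s hs
        rcases Finset.mem_insert.1 hs with rfl | hs
        · exact ⟨le_rfl, hi⟩
        · have := hS1 s hs; omega
      · have hfar : ∀ s ∈ S, ∀ c ∈ intLattice, ε / 2 ≤ ‖x s - x i - c‖ := by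
          intro s hs c hc
          by_contra hcon
          exact hlast s (by have := hS1 s hs; omega) (hS1 s hs).2 ⟨c, hc, not_le.1 hcon⟩
        intro s hs s' hs' hne c hc
        rcases Finset.mem_insert.1 hs with hsi | hsS
        · rcases Finset.mem_insert.1 hs' with hsi' | hsS'
          · exact (hne (hsi.trans hsi'.symm)).elim
          · rw [hsi]; exact hfar s' hsS' c hc
        · rcases Finset.mem_insert.1 hs' with hsi' | hsS'
          · rw [hsi']
            have := hfar s hsS (-c) (intLattice.neg_mem hc)
            have e : x i - x s - c = -(x s - x i - -c) := by abel
            rw [e, norm_neg]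
            exact this
          · exact hS2 s hsS s' hsS' hne c hc
      · rw [Finset.card_insert_of_notMem hiS]; omega
      · rw [Finset.card_insert_of_notMem hiS]; omega
      · intro M
        have h1 := reach_straight x n ε i (j + 1 - i) (by omega)
        have e : i + (j + 1 - i) = j + 1 := by omega
        rw [e] at h1
        have h2 := ((hc1R.loop M).trans h1).trans (hS5 M)
        rw [add_zero, ← nsmul_add] at h2
        convert h2 using 1
        rw [mul_add]
        omega
      · intro h0
        rw [hc10 (by omega), hS6 (by omega), add_zero]
      · intro v O hO
        rw [Finset.card_insert_of_notMem hiS]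
        have h1 := hS7 v O hO
        have h2 := hx j hlt
        rw [dist_comm, dist_eq_norm] at h2
        have h3 := hO (x j)
        have e : x n - x i - (c1 + w) - (((S.card + 1 : ℕ) : ℝ) - 1) • v
            = (x n - x (j + 1) - w - ((S.card : ℝ) - 1) • v) + (x (j + 1) - F (x j))
              + (F (x j) - x j - v) + (x j - x i - c1) := by
          push_cast
          module
        rw [e]
        have a1 := norm_add_le ((x n - x (j + 1) - w - ((S.card : ℝ) - 1) • v)
          + (x (j + 1) - F (x j)) + (F (x j) - x j - v)) (x j - x i - c1)
        have a2 := norm_add_le ((x n - x (j + 1) - w - ((S.card : ℝ) - 1) • v)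
          + (x (j + 1) - F (x j))) (F (x j) - x j - v)
        have a3 := norm_add_le (x n - x (j + 1) - w - ((S.card : ℝ) - 1) • v)
          (x (j + 1) - F (x j))
        push_cast
        linarith

lemma osc_nonneg (F : R2 ≃ₜ R2) (hF : Equi F) : 0 ≤ osc F :=
  (norm_nonneg _).trans (osc_bound F hF 0 0)

lemma deviation (F : R2 ≃ₜ R2) (hF : Equi F) (ε : ℝ) (hε0 : 0 < ε) (hε1 : ε < 1)
    (hst : UpperStable Homeo0 F ε) (x : ℕ → R2) (n : ℕ)
    (hx : IsPseudoOrbitUpTo F (ε / 2) x n)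
    (hne : (rotSet F).Nonempty ∨ 16 / (Real.pi * ε ^ 2) ≤ n) :
    ∃ v ∈ rotSet F, ‖x n - x 0 - (n : ℝ) • v‖ ≤ (16 / (Real.pi * ε ^ 2)) * (osc F + 2) + ε := by
  obtain ⟨S, L, w, -, hS2, hS3, hS4, hS5, hS6, hS7⟩ :=
    greedy F x n ε hε0 hx n 0 (Nat.zero_le _) (by omega)
  have hpack := packing x ε hε0 hε1 S hS2
  have hosc := osc_nonneg F hF
  have hcard : (1 : ℝ) ≤ S.card := by exact_mod_cast hS3
  have hn : (n : ℝ) = L + ((S.card : ℝ) - 1) := by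
    have : ((n + 1 : ℕ) : ℝ) = ((0 + L + S.card : ℕ) : ℝ) := by rw [hS4]
    push_cast at this
    linarith
  have key : ∃ v ∈ rotSet F, w = (L : ℝ) • v := by
    rcases Nat.eq_zero_or_pos L with h | h
    · have hn' : (rotSet F).Nonempty := by
        rcases hne with h1 | h1
        · exact h1
        · rw [h] at hn
          simp at hn
          linarith
      obtain ⟨v, hv⟩ := hn'
      exact ⟨v, hv, by rw [hS6 h, h]; simp⟩
    · have hL : (L : ℝ) ≠ 0 := by positivity
      refine ⟨(L : ℝ)⁻¹ • w, ?_, by rw [smul_smul, mul_inv_cancel₀ hL, one_smul]⟩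
      refine reach_rot F hF ε hε0 hst n x (PE x n ε) (pc x ε) ?_ ?_ ?_ 0 n (n - 0) L w
        (Nat.zero_le _) le_rfl h hS5
      · rintro a b ⟨h1, h2 | h2⟩
        · omega
        · have := h2.1; omega
      · rintro a b ⟨h1, h2 | h2⟩
        · rw [h2, pc_succ]; exact intLattice.zero_mem
        · exact (pc_spec x ε a b h2.1 h2.2).1
      · rintro a b ⟨h1, h2⟩
        have h3 := hx a h1
        rw [dist_comm, dist_eq_norm] at h3
        rcases h2 with h2 | h2
        · rw [h2, pc_succ, add_zero]; linarith
        · have h4 := (pc_spec x ε a b h2.1 h2.2).2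
          have e : x b + pc x ε a b - F (x a) =
              (x (a + 1) - F (x a)) - (x (a + 1) - x b - pc x ε a b) := by abel
          rw [e]
          have := norm_sub_le (x (a + 1) - F (x a)) (x (a + 1) - x b - pc x ε a b)
          linarith
  obtain ⟨v, hv, hw⟩ := key
  refine ⟨v, hv, ?_⟩
  have h1 := hS7 v (osc F) (osc_rot F hF v hv)
  have e : x n - x 0 - (n : ℝ) • v = x n - x 0 - w - ((S.card : ℝ) - 1) • v := by
    rw [hw, hn]; module
  rw [e]
  refine h1.trans ?_
  have h2 : ((S.card : ℝ) - 1) * (osc F + ε) ≤ (16 / (Real.pi * ε ^ 2)) * (osc F + 2) := by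
    apply mul_le_mul <;> linarith
  linarith
/-- If `f ∈ Homeo₀(T²)` has an `ε`-upper-stable rotation set with
`0 < ε < 1`, then for any lift `F` of `f` one has `ρ_{ε/2}(F) = ρ(F)`, and every
`(ε/2)`-pseudo-orbit `(x̃_i)` of `F` satisfies, for all `n`,
`d(x̃_n − x̃_0, n·ρ(F)) ≤ (16/(πε²))·(osc(f) + 2) + ε`. -/
theorem pseudo_orbit_deviation_bound_of_upper_stable (f : T2 ≃ₜ T2) (hf : f ∈ Homeo0)
    (ε : ℝ) (hε0 : 0 < ε) (hε1 : ε < 1)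
    (hstab : ∃ F₀ : R2 ≃ₜ R2, IsLift f F₀ ∧ UpperStable Homeo0 F₀ ε) :
    ∀ F : R2 ≃ₜ R2, IsLift f F →
      pseudoRotSet (⇑F) (ε / 2) = rotSet F ∧
      ∀ x : ℕ → R2, IsPseudoOrbit (⇑F) (ε / 2) x → ∀ n : ℕ,
        Metric.infDist (x n - x 0) ((n : ℝ) • rotSet F) ≤
          (16 / (Real.pi * ε ^ 2)) * (osc (⇑F) + 2) + ε := by
  intro F hF
  obtain ⟨F₀, hF₀, hst₀⟩ := hstab
  have hst := stable_any_lift hF hF₀ hst₀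
  have hE : Equi F := hF.equivariant
  have hpi := Real.pi_pos
  set N := 16 / (Real.pi * ε ^ 2) with hN
  have hN0 : 0 < N := by positivity
  have hosc := osc_nonneg F hE
  have hB : 0 ≤ N * (osc F + 2) + ε := by positivity
  refine ⟨Subset.antisymm ?_ ?_, ?_⟩
  · rintro v ⟨n, x, hn, hx, hlim⟩
    apply rotSet_of_approx
    intro η hη
    obtain ⟨M, hM⟩ := exists_nat_gt ((N * (osc F + 2) + ε) / (η / 2) + N)
    have h1 := hn.eventually_ge_atTop M
    have h2 := (Metric.tendsto_nhds.1 hlim) (η / 2) (by positivity)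
    obtain ⟨k, hk1, hk2⟩ := (h1.and h2).exists
    have hq : 0 ≤ (N * (osc F + 2) + ε) / (η / 2) := by positivity
    have hMk : (M : ℝ) ≤ n k := by exact_mod_cast hk1
    have hnk : (0 : ℝ) < n k := by linarith
    obtain ⟨v', hv', hd⟩ := deviation F hE ε hε0 hε1 hst (x k) (n k) (hx k)
      (Or.inr (by rw [← hN]; linarith))
    rw [← hN] at hd
    refine ⟨v', hv', ?_⟩
    rw [dist_eq_norm] at hk2
    have h3 : ‖(n k : ℝ)⁻¹ • (x k (n k) - x k 0) - v'‖ ≤ η / 2 := by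
      have e : (n k : ℝ)⁻¹ • (x k (n k) - x k 0) - v'
          = (n k : ℝ)⁻¹ • (x k (n k) - x k 0 - (n k : ℝ) • v') := by
        rw [smul_sub _ _ ((n k : ℝ) • v'), smul_smul, inv_mul_cancel₀ hnk.ne', one_smul]
      rw [e, norm_smul, norm_inv, Real.norm_of_nonneg hnk.le, inv_mul_le_iff₀ hnk]
      have h4 : (N * (osc F + 2) + ε) / (η / 2) ≤ n k := by linarith
      rw [div_le_iff₀ (by positivity)] at h4
      linarith
    have h5 := norm_sub_le ((n k : ℝ)⁻¹ • (x k (n k) - x k 0) - v)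
      ((n k : ℝ)⁻¹ • (x k (n k) - x k 0) - v')
    rw [sub_sub_sub_cancel_left] at h5
    linarith
  · rintro v ⟨z, n, hn, hlim⟩
    refine ⟨n, fun k i => (⇑F)^[i] (z k), hn, fun k i _ => ?_, hlim⟩
    simp only [Function.iterate_succ_apply']
    rw [dist_self]
    positivity
  · intro x hx n
    rcases (rotSet F).eq_empty_or_nonempty with h | h
    · rw [h, smul_set_empty, infDist_empty]
      exact hB
    · obtain ⟨v, hv, hd⟩ := deviation F hE ε hε0 hε1 hst x n (fun i _ => hx i) (Or.inl h)
      refine (infDist_le_dist_of_mem (smul_mem_smul_set hv)).trans ?_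
      rw [dist_eq_norm]
      exact hd
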